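/- arXiv:1207.6453 — 3 statements merged into one kernel-verified Lean document; each statement's English description precedes it below -/
import Mathlib

section
/- The first derivative of d is strictly positive throughout the interval [5.13, 5.33]: d'(t) > 0 for all t with 5.13 ≤ t ≤ 5.33. -/
open MeasureTheory

/-- `G₊(x) = |1 + e(x) + e(7x)|² = 3 + 2(cos 2πx + cos 12πx + cos 14πx)`. -/
noncomputable def Gp (x : ℝ) : ℝ :=
  3 + 2 * (Real.cos (2 * Real.pi * x) + Real.cos (12 * Real.pi * x) + Real.cos (14 * Real.pi * x))

/-- `G₋(x) = |1 + e(x) − e(7x)|² = 3 + 2(cos 2πx − cos 12πx − cos 14πx)`. -/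
noncomputable def Gm (x : ℝ) : ℝ :=
  3 + 2 * (Real.cos (2 * Real.pi * x) - Real.cos (12 * Real.pi * x) - Real.cos (14 * Real.pi * x))

/-- `d(t) = ∫₀^{1/2} (G₋ᵗ − G₊ᵗ)`, real powers (`0^t = 0` for `t ≠ 0`). -/
noncomputable def d (t : ℝ) : ℝ := ∫ x in (0:ℝ)..(1/2), (Gm x ^ t - Gp x ^ t)

/-! ### Tails of the binomial series -/

/-- `∏_{j < n} (K + j - t) / (K + j + 1)`; for `K = 0` this is the `n`-th Taylor coefficient of
`u ↦ (1 - u) ^ t` at `0`. -/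
noncomputable def binTail (K : ℕ) (t : ℝ) : ℕ → ℝ
  | 0 => 1
  | n + 1 => binTail K t n * ((K + n - t) / (K + n + 1))

/-- The derivative of `binTail K t n` in `t`. -/
noncomputable def binTailDeriv (K : ℕ) (t : ℝ) : ℕ → ℝ
  | 0 => 0
  | n + 1 => binTailDeriv K t n * ((K + n - t) / (K + n + 1)) - binTail K t n / (K + n + 1)

lemma hasDerivAt_binTail (K : ℕ) (n : ℕ) (t : ℝ) :
    HasDerivAt (fun s => binTail K s n) (binTailDeriv K t n) t := by
  induction n with
  | zero => exact hasDerivAt_const t 1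
  | succ n ih =>
    have h : HasDerivAt (fun s : ℝ => ((K + n - s) / (K + n + 1) : ℝ)) (-1 / (K + n + 1)) t := by
      simpa using ((hasDerivAt_id t).const_sub (K + n : ℝ)).div_const (K + n + 1 : ℝ)
    exact (ih.mul h).congr_deriv (by simp only [binTailDeriv]; ring)

lemma binTail_add (K : ℕ) (t : ℝ) (n : ℕ) :
    binTail 0 t (K + n) = binTail 0 t K * binTail K t n := by
  induction n with
  | zero => simp [binTail]
  | succ n ih =>
    rw [← add_assoc]
    simp only [binTail, ih]
    push_cast
    ring

lemma binTail_succ' (K : ℕ) (t : ℝ) (n : ℕ) :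
    binTail K t (n + 1) = (K - t) / (K + 1) * binTail (K + 1) t n := by
  induction n with
  | zero => simp [binTail]
  | succ n ih =>
    rw [binTail, ih, binTail]
    push_cast
    rw [show (K : ℝ) + (n + 1) - t = K + 1 + n - t by ring,
      show (K : ℝ) + (n + 1) + 1 = K + 1 + n + 1 by ring]
    ring

lemma binTail_nonneg {K : ℕ} {t : ℝ} (ht : t ≤ K) (n : ℕ) : 0 ≤ binTail K t n := by
  induction n with
  | zero => simp [binTail]
  | succ n ih =>
    refine mul_nonneg ih (div_nonneg ?_ (by positivity))
    have : (0 : ℝ) ≤ n := n.cast_nonneg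
    linarith

lemma binTail_anti {K : ℕ} {s t : ℝ} (hst : s ≤ t) (ht : t ≤ K) (n : ℕ) :
    binTail K t n ≤ binTail K s n := by
  induction n with
  | zero => simp [binTail]
  | succ n ih =>
    have hn : (0 : ℝ) ≤ n := n.cast_nonneg
    exact mul_le_mul ih (by gcongr) (div_nonneg (by linarith) (by positivity))
      (binTail_nonneg (hst.trans ht) n)

lemma abs_binTailDeriv_le {K : ℕ} {t : ℝ} (ht : t ≤ K) (n : ℕ) :
    |binTailDeriv K t n| ≤ binTail K (t - 1) n := by
  induction n with
  | zero => simp [binTail, binTailDeriv]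
  | succ n ih =>
    have hn : (0 : ℝ) ≤ n := n.cast_nonneg
    have hp : (0 : ℝ) < K + n + 1 := by positivity
    have h0 := binTail_nonneg ht n
    have h1 := binTail_anti (show t - 1 ≤ t by linarith) ht n
    have hq : 0 ≤ ((K : ℝ) + n - t) / (K + n + 1) := div_nonneg (by linarith) hp.le
    calc |binTailDeriv K t (n + 1)|
        ≤ |binTailDeriv K t n * ((K + n - t) / (K + n + 1))| + |binTail K t n / (K + n + 1)| :=
          abs_sub _ _
      _ = |binTailDeriv K t n| * ((K + n - t) / (K + n + 1)) + binTail K t n / (K + n + 1) := by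
          rw [abs_mul, abs_of_nonneg hq, abs_of_nonneg (div_nonneg h0 hp.le)]
      _ ≤ binTail K (t - 1) n * ((K + n - t) / (K + n + 1))
            + binTail K (t - 1) n / (K + n + 1) := by gcongr
      _ = binTail K (t - 1) (n + 1) := by simp only [binTail]; ring

lemma sum_binTail {K : ℕ} {s : ℝ} (hs : s ≠ 0) (N : ℕ) :
    ∑ n ∈ Finset.range N, binTail K s n = K / s - binTail K s N * (K + N) / s := by
  induction N with
  | zero => simp [binTail]
  | succ N ih =>
    have hp : (K : ℝ) + N + 1 ≠ 0 := by positivity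
    rw [Finset.sum_range_succ, ih, binTail]
    push_cast
    field_simp
    ring

lemma sum_binTail_le {K : ℕ} {s : ℝ} (hs : 0 < s) (hsK : s ≤ K) (N : ℕ) :
    ∑ n ∈ Finset.range N, binTail K s n ≤ K / s := by
  rw [sum_binTail hs.ne']
  have := binTail_nonneg hsK N
  have : 0 ≤ binTail K s N * (K + N) / s := by positivity
  linarith

lemma summable_binTail {K : ℕ} {s : ℝ} (hs : 0 < s) (hsK : s ≤ K) : Summable (binTail K s) :=
  summable_of_sum_range_le (binTail_nonneg hsK) (sum_binTail_le hs hsK)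

lemma tsum_binTail_le {K : ℕ} {s : ℝ} (hs : 0 < s) (hsK : s ≤ K) :
    ∑' n, binTail K s n ≤ K / s :=
  Real.tsum_le_of_sum_range_le (binTail_nonneg hsK) (sum_binTail_le hs hsK)

lemma summable_abs_binTail_zero {t : ℝ} (ht : 0 < t) : Summable fun n => |binTail 0 t n| := by
  obtain ⟨K, hK⟩ := exists_nat_ge t
  rw [← summable_nat_add_iff K]
  refine ((summable_binTail ht hK).mul_left |binTail 0 t K|).congr fun n => ?_
  rw [add_comm n K, binTail_add, abs_mul, abs_of_nonneg (binTail_nonneg hK n)]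

lemma ringChoose_mul_neg_one_pow (t : ℝ) (n : ℕ) :
    Ring.choose t n * (-1) ^ n = binTail 0 t n := by
  have key : ∀ n : ℕ, (descPochhammer ℤ n).smeval t * (-1) ^ n = n.factorial * binTail 0 t n := by
    intro n
    induction n with
    | zero => simp [binTail]
    | succ n ih =>
      have hn : (n : ℝ) + 1 ≠ 0 := by positivity
      rw [descPochhammer_succ_right, Polynomial.smeval_mul, Polynomial.smeval_sub,
        Polynomial.smeval_X, Polynomial.smeval_natCast, binTail, Nat.factorial_succ, pow_succ]
      push_cast
      field_simp
      simp only [nsmul_eq_mul, mul_one]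
      linear_combination (n - t) * (n + 1) * ih
  have h := Ring.descPochhammer_eq_factorial_smul_choose t n
  have hf : (n.factorial : ℝ) ≠ 0 := by positivity
  have h2 := key n
  rw [h, nsmul_eq_mul, mul_assoc] at h2
  exact mul_left_cancel₀ hf h2

lemma hasSum_binTail_mul_pow_of_lt {t u : ℝ} (hu : |u| < 1) :
    HasSum (fun n => binTail 0 t n * u ^ n) ((1 - u) ^ t) := by
  have h := (Real.one_add_rpow_hasFPowerSeriesOnBall_zero (a := t)).hasSum (y := -u) (by
    simpa [Metric.mem_eball, edist_dist, Real.dist_eq] using hu)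
  have hterm : (fun n => binTail 0 t n * u ^ n) = fun n => binomialSeries ℝ t n fun _ => -u := by
    ext n
    rw [binomialSeries_apply, ← ringChoose_mul_neg_one_pow]
    simp [neg_pow u n, mul_assoc]
  rw [hterm, show 1 - u = 1 + (0 + -u) by ring]
  exact h

lemma hasSum_binTail_mul_pow {t u : ℝ} (ht : 0 < t) (hu : |u| ≤ 1) :
    HasSum (fun n => binTail 0 t n * u ^ n) ((1 - u) ^ t) := by
  have hb : ∀ n, ∀ v ∈ Set.Icc (-1 : ℝ) 1, ‖binTail 0 t n * v ^ n‖ ≤ |binTail 0 t n| := by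
    intro n v hv
    rw [norm_mul, norm_pow, Real.norm_eq_abs, Real.norm_eq_abs]
    exact mul_le_of_le_one_right (abs_nonneg _) (pow_le_one₀ (abs_nonneg _) (abs_le.2 hv))
  have hs := summable_abs_binTail_zero ht
  have hcont : ContinuousOn (fun v : ℝ => ∑' n, binTail 0 t n * v ^ n) (Set.Icc (-1) 1) :=
    continuousOn_tsum (fun n => by fun_prop) hs hb
  have hcont' : ContinuousOn (fun v : ℝ => (1 - v) ^ t) (Set.Icc (-1) 1) :=
    (Continuous.rpow_const (by fun_prop) fun _ => Or.inr ht.le).continuousOn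
  have heq : Set.EqOn (fun v : ℝ => ∑' n, binTail 0 t n * v ^ n) (fun v => (1 - v) ^ t)
      (Set.Ioo (-1) 1) := fun v hv => (hasSum_binTail_mul_pow_of_lt (abs_lt.2 hv)).tsum_eq
  have heq' := heq.of_subset_closure hcont hcont' Set.Ioo_subset_Icc_self
    (by rw [closure_Ioo (by norm_num)])
  have hmem := abs_le.1 hu
  have hsum : Summable fun n => binTail 0 t n * u ^ n :=
    Summable.of_norm_bounded hs fun n => hb n u hmem
  have := hsum.hasSum
  rwa [show ∑' n, binTail 0 t n * u ^ n = (1 - u) ^ t from heq' hmem] at this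

/-! ### Reduction of `d` to a series in the moments of `1 - G / 5` -/

lemma Gm_mem_Icc (x : ℝ) : Gm x ∈ Set.Icc (0 : ℝ) 9 := by
  have h : Gm x = (1 + Real.cos (2 * Real.pi * x) - Real.cos (14 * Real.pi * x)) ^ 2
      + (Real.sin (2 * Real.pi * x) - Real.sin (14 * Real.pi * x)) ^ 2 := by
    have h12 : Real.cos (12 * Real.pi * x) = Real.cos (14 * Real.pi * x - 2 * Real.pi * x) := by
      ring_nf
    rw [Gm, h12, Real.cos_sub]
    nlinarith [Real.sin_sq_add_cos_sq (2 * Real.pi * x), Real.sin_sq_add_cos_sq (14 * Real.pi * x)]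
  refine ⟨by rw [h]; positivity, ?_⟩
  rw [Gm]
  linarith [Real.cos_le_one (2 * Real.pi * x), Real.neg_one_le_cos (12 * Real.pi * x),
    Real.neg_one_le_cos (14 * Real.pi * x)]

lemma Gp_mem_Icc (x : ℝ) : Gp x ∈ Set.Icc (0 : ℝ) 9 := by
  have h : Gp x = (1 + Real.cos (2 * Real.pi * x) + Real.cos (14 * Real.pi * x)) ^ 2
      + (Real.sin (2 * Real.pi * x) + Real.sin (14 * Real.pi * x)) ^ 2 := by
    have h12 : Real.cos (12 * Real.pi * x) = Real.cos (14 * Real.pi * x - 2 * Real.pi * x) := by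
      ring_nf
    rw [Gp, h12, Real.cos_sub]
    nlinarith [Real.sin_sq_add_cos_sq (2 * Real.pi * x), Real.sin_sq_add_cos_sq (14 * Real.pi * x)]
  refine ⟨by rw [h]; positivity, ?_⟩
  rw [Gp]
  linarith [Real.cos_le_one (2 * Real.pi * x), Real.cos_le_one (12 * Real.pi * x),
    Real.cos_le_one (14 * Real.pi * x)]

lemma continuous_Gm : Continuous Gm := by unfold Gm; fun_prop

lemma continuous_Gp : Continuous Gp := by unfold Gp; fun_prop

lemma abs_one_sub_div_five_le {v : ℝ} (hv : v ∈ Set.Icc (0 : ℝ) 9) : |1 - v / 5| ≤ 1 :=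
  abs_le.2 ⟨by linarith [hv.2], by linarith [hv.1]⟩

lemma hasSum_integral_binTail {g : ℝ → ℝ} (hg : Continuous g) (hg1 : ∀ x, |g x| ≤ 1) {t : ℝ}
    (ht : 0 < t) (a b : ℝ) :
    HasSum (fun n => binTail 0 t n * ∫ x in a..b, g x ^ n) (∫ x in a..b, (1 - g x) ^ t) := by
  have hs := summable_abs_binTail_zero ht
  have := intervalIntegral.hasSum_integral_of_dominated_convergence (μ := volume) (a := a) (b := b)
    (F := fun n x => binTail 0 t n * g x ^ n) (f := fun x => (1 - g x) ^ t)
    (fun n _ => |binTail 0 t n|) (fun n => Continuous.aestronglyMeasurable (by fun_prop))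
    (fun n => .of_forall fun x _ => by
      rw [norm_mul, norm_pow, Real.norm_eq_abs, Real.norm_eq_abs]
      exact mul_le_of_le_one_right (abs_nonneg _) (pow_le_one₀ (abs_nonneg _) (hg1 x)))
    (.of_forall fun x _ => hs) intervalIntegrable_const
    (.of_forall fun x _ => hasSum_binTail_mul_pow ht (hg1 x))
  simpa only [intervalIntegral.integral_const_mul] using this

/-- Difference of the `n`-th moments of `1 - G₋ / 5` and `1 - G₊ / 5`. -/
noncomputable def momentDiff (n : ℕ) : ℝ :=
  (∫ x in (0:ℝ)..(1/2), (1 - Gm x / 5) ^ n) - ∫ x in (0:ℝ)..(1/2), (1 - Gp x / 5) ^ n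

lemma abs_momentDiff_le (n : ℕ) : |momentDiff n| ≤ 1 := by
  have key : ∀ g : ℝ → ℝ, (∀ x, g x ∈ Set.Icc (0 : ℝ) 9) →
      |∫ x in (0:ℝ)..(1/2), (1 - g x / 5) ^ n| ≤ 1 / 2 := by
    intro g hg
    have := intervalIntegral.norm_integral_le_of_norm_le_const (a := (0:ℝ)) (b := 1 / 2) (C := 1)
      (f := fun x => (1 - g x / 5) ^ n) fun x _ => by
        rw [norm_pow, Real.norm_eq_abs]
        exact pow_le_one₀ (abs_nonneg _) (abs_one_sub_div_five_le (hg x))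
    rw [Real.norm_eq_abs] at this
    norm_num at this ⊢
    exact this
  have h1 := key Gm Gm_mem_Icc
  have h2 := key Gp Gp_mem_Icc
  have := abs_sub (∫ x in (0:ℝ)..(1/2), (1 - Gm x / 5) ^ n)
    (∫ x in (0:ℝ)..(1/2), (1 - Gp x / 5) ^ n)
  rw [momentDiff]
  linarith

lemma hasSum_binTail_mul_momentDiff {t : ℝ} (ht : 0 < t) :
    HasSum (fun n => binTail 0 t n * momentDiff n) (d t / 5 ^ t) := by
  have hm := hasSum_integral_binTail (g := fun x => 1 - Gm x / 5)
    (by have := continuous_Gm; fun_prop) (fun x => abs_one_sub_div_five_le (Gm_mem_Icc x)) ht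
    0 (1 / 2)
  have hp := hasSum_integral_binTail (g := fun x => 1 - Gp x / 5)
    (by have := continuous_Gp; fun_prop) (fun x => abs_one_sub_div_five_le (Gp_mem_Icc x)) ht
    0 (1 / 2)
  have hcm : Continuous fun x => Gm x ^ t := continuous_Gm.rpow_const fun _ => Or.inr ht.le
  have hcp : Continuous fun x => Gp x ^ t := continuous_Gp.rpow_const fun _ => Or.inr ht.le
  have hd : d t / 5 ^ t = (∫ x in (0:ℝ)..(1/2), (1 - (1 - Gm x / 5)) ^ t)
      - ∫ x in (0:ℝ)..(1/2), (1 - (1 - Gp x / 5)) ^ t := by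
    simp only [sub_sub_cancel]
    simp_rw [fun x => Real.div_rpow (Gm_mem_Icc x).1 (by norm_num : (0:ℝ) ≤ 5) t,
      fun x => Real.div_rpow (Gp_mem_Icc x).1 (by norm_num : (0:ℝ) ≤ 5) t]
    rw [intervalIntegral.integral_div, intervalIntegral.integral_div, d,
      intervalIntegral.integral_sub (hcm.intervalIntegrable _ _) (hcp.intervalIntegrable _ _),
      sub_div]
  rw [hd]
  refine (hm.sub hp).congr_fun fun n => ?_
  rw [momentDiff, mul_sub]

/-- The tail from index `K` on of the series for `d t / 5 ^ t`, with the factor `binTail 0 t K`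
removed. -/
noncomputable def tailSum (K : ℕ) (t : ℝ) : ℝ := ∑' n, momentDiff (K + n) * binTail K t n

lemma d_eq (K : ℕ) {t : ℝ} (ht : 0 < t) :
    d t = 5 ^ t * (∑ n ∈ Finset.range K, momentDiff n * binTail 0 t n
      + binTail 0 t K * tailSum K t) := by
  have h := hasSum_binTail_mul_momentDiff ht
  have h5 : (5 : ℝ) ^ t ≠ 0 := by positivity
  have h2 := h.summable.sum_add_tsum_nat_add K
  rw [h.tsum_eq] at h2
  rw [eq_div_iff h5] at h2
  rw [← h2, mul_comm, tailSum, ← tsum_mul_left]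
  congr 2
  · exact Finset.sum_congr rfl fun n _ => mul_comm _ _
  · refine tsum_congr fun n => ?_
    rw [add_comm n K, binTail_add]
    ring

lemma abs_tailSum_le {K : ℕ} {s t : ℝ} (hs : 0 < s) (hst : s ≤ t) (ht : t ≤ K) :
    |tailSum K t| ≤ K / s := by
  rw [tailSum, ← Real.norm_eq_abs]
  refine le_trans (tsum_of_norm_bounded (summable_binTail hs (hst.trans ht)).hasSum fun n => ?_)
    (tsum_binTail_le hs (hst.trans ht))
  rw [norm_mul, Real.norm_eq_abs, Real.norm_eq_abs, abs_of_nonneg (binTail_nonneg ht n)]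
  exact (mul_le_of_le_one_left (binTail_nonneg ht n) (abs_momentDiff_le _)).trans
    (binTail_anti hst ht n)

lemma exists_hasDerivAt_tailSum {K : ℕ} {s t : ℝ} (hs : 0 < s) (hst : s + 1 < t) (ht : t < K) :
    ∃ q, |q| ≤ K / s ∧ HasDerivAt (tailSum K) q t := by
  have hsK : s ≤ K := by linarith
  have hbound : ∀ n, ∀ y ∈ Set.Ioo (s + 1) (K : ℝ),
      ‖momentDiff (K + n) * binTailDeriv K y n‖ ≤ binTail K s n := by
    intro n y hy
    rw [norm_mul, Real.norm_eq_abs, Real.norm_eq_abs]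
    exact (mul_le_of_le_one_left (abs_nonneg _) (abs_momentDiff_le _)).trans
      ((abs_binTailDeriv_le hy.2.le n).trans
        (binTail_anti (by linarith [hy.1]) (by linarith [hy.2]) n))
  have hsum : Summable fun n => momentDiff (K + n) * binTail K t n := by
    refine Summable.of_norm_bounded (summable_binTail (by linarith) ht.le) fun n => ?_
    rw [norm_mul, Real.norm_eq_abs, Real.norm_eq_abs, abs_of_nonneg (binTail_nonneg ht.le n)]
    exact mul_le_of_le_one_left (binTail_nonneg ht.le n) (abs_momentDiff_le _)
  refine ⟨_, ?_, hasDerivAt_tsum_of_isPreconnected (summable_binTail hs hsK) isOpen_Ioo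
    isPreconnected_Ioo (fun n y _ => (hasDerivAt_binTail K n y).const_mul _) hbound ⟨hst, ht⟩ hsum
    ⟨hst, ht⟩⟩
  exact (tsum_of_norm_bounded (summable_binTail hs hsK).hasSum fun n => hbound n t ⟨hst, ht⟩).trans
    (tsum_binTail_le hs hsK)

/-! ### Exact moments through cosine sums -/

/-- Coefficientwise sum of two coefficient lists. -/
def addList {α : Type*} [Add α] : List α → List α → List α
  | [], m => m
  | a :: l, [] => a :: l
  | a :: l, b :: m => (a + b) :: addList l m

/-- Scalar multiple of a coefficient list. -/
def scaleList {α : Type*} [Mul α] (c : α) (l : List α) : List α := l.map (c * ·)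

/-- Prepend `n` zero coefficients. -/
def padList (n : ℕ) (l : List ℤ) : List ℤ := List.replicate n 0 ++ l

/-- `∑ j, l[j] cos (2π (c + j) x)`. -/
noncomputable def cosSum : List ℤ → ℤ → ℝ → ℝ
  | [], _, _ => 0
  | a :: l, c, x => a * Real.cos (2 * Real.pi * c * x) + cosSum l (c + 1) x

/-- Coefficients, starting from frequency `c - 7`, of `5 - G₊` (for `s = 1`) or `5 - G₋`
(for `s = -1`) times the cosine sum with coefficients `l` starting from frequency `c`. -/
def stepList (s : ℤ) (l : List ℤ) : List ℤ :=
  addList (padList 7 (scaleList 2 l))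
    (addList (scaleList (-1) (addList (padList 6 l) (padList 8 l)))
      (scaleList (-s) (addList (addList (padList 1 l) (padList 13 l))
        (addList l (padList 14 l)))))

/-- The constant coefficient of a cosine sum starting from frequency `c`. -/
def constCoeff : List ℤ → ℤ → ℤ
  | [], _ => 0
  | a :: l, c => (if c = 0 then a else 0) + constCoeff l (c + 1)

/-- The constant coefficients of `(5 - G)^k`, `k < n`, times the initial cosine sum. -/
def moments (s : ℤ) : ℕ → List ℤ → ℤ → List ℤ
  | 0, _, _ => []
  | n + 1, l, c => constCoeff l c :: moments s n (stepList s l) (c - 7)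

lemma cosSum_addList (l m : List ℤ) (c : ℤ) (x : ℝ) :
    cosSum (addList l m) c x = cosSum l c x + cosSum m c x := by
  induction l generalizing m c with
  | nil => simp [addList, cosSum]
  | cons a l ih =>
    cases m with
    | nil => simp [addList, cosSum]
    | cons b m =>
      simp only [addList, cosSum, ih]
      push_cast
      ring

lemma cosSum_scaleList (r : ℤ) (l : List ℤ) (c : ℤ) (x : ℝ) :
    cosSum (scaleList r l) c x = r * cosSum l c x := by
  induction l generalizing c with
  | nil => simp [scaleList, cosSum]
  | cons a l ih =>
    have := ih (c + 1)
    simp only [scaleList] at this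
    simp only [scaleList, List.map_cons, cosSum, this]
    push_cast
    ring

lemma cosSum_padList (n : ℕ) (l : List ℤ) (c : ℤ) (x : ℝ) :
    cosSum (padList n l) c x = cosSum l (c + n) x := by
  induction n generalizing c with
  | zero => simp [padList]
  | succ n ih =>
    have := ih (c + 1)
    simp only [padList] at this
    simp only [padList, List.replicate_succ, List.cons_append, cosSum, this]
    push_cast
    ring_nf

lemma cosSum_add_cosSum_sub (i : ℤ) (l : List ℤ) (c : ℤ) (x : ℝ) :
    cosSum l (c - i) x + cosSum l (c + i) x
      = 2 * Real.cos (2 * Real.pi * i * x) * cosSum l c x := by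
  induction l generalizing c with
  | nil => simp [cosSum]
  | cons a l ih =>
    have h := ih (c + 1)
    rw [show c + 1 - i = c - i + 1 by ring, show c + 1 + i = c + i + 1 by ring] at h
    simp only [cosSum]
    push_cast
    rw [show 2 * Real.pi * ((c : ℝ) - i) * x = 2 * Real.pi * c * x - 2 * Real.pi * i * x by ring,
      show 2 * Real.pi * ((c : ℝ) + i) * x = 2 * Real.pi * c * x + 2 * Real.pi * i * x by ring,
      Real.cos_sub, Real.cos_add]
    linear_combination h

lemma cosSum_stepList (s : ℤ) (l : List ℤ) (c : ℤ) (x : ℝ) :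
    cosSum (stepList s l) (c - 7) x
      = (5 - (3 + 2 * (Real.cos (2 * Real.pi * x) + s * Real.cos (12 * Real.pi * x)
          + s * Real.cos (14 * Real.pi * x)))) * cosSum l c x := by
  simp only [stepList, cosSum_addList, cosSum_scaleList, cosSum_padList]
  have h1 := cosSum_add_cosSum_sub 1 l c x
  have h6 := cosSum_add_cosSum_sub 6 l c x
  have h7 := cosSum_add_cosSum_sub 7 l c x
  push_cast at h1 h6 h7 ⊢
  rw [show c - 7 + 7 = c by ring, show c - 7 + 6 = c - 1 by ring, show c - 7 + 8 = c + 1 by ring,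
    show c - 7 + 1 = c - 6 by ring, show c - 7 + 13 = c + 6 by ring,
    show c - 7 + 14 = c + 7 by ring]
  rw [show 2 * Real.pi * 1 * x = 2 * Real.pi * x by ring] at h1
  rw [show 2 * Real.pi * 6 * x = 12 * Real.pi * x by ring] at h6
  rw [show 2 * Real.pi * 7 * x = 14 * Real.pi * x by ring] at h7
  linear_combination -h1 - s * h6 - s * h7

lemma continuous_cosSum (l : List ℤ) (c : ℤ) : Continuous (cosSum l c) := by
  induction l generalizing c with
  | nil => exact continuous_const
  | cons a l ih =>
    have := ih (c + 1)
    change Continuous fun x => a * Real.cos (2 * Real.pi * c * x) + cosSum l (c + 1) x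
    fun_prop

lemma integral_cos_two_pi_int_mul (c : ℤ) :
    ∫ x in (0:ℝ)..(1/2), Real.cos (2 * Real.pi * c * x) = if c = 0 then 1 / 2 else 0 := by
  split_ifs with h
  · simp [h]
  · have hc : 2 * Real.pi * (c : ℝ) ≠ 0 := by
      have : (c : ℝ) ≠ 0 := by exact_mod_cast h
      positivity
    rw [intervalIntegral.integral_comp_mul_left (fun y => Real.cos y) hc, integral_cos,
      show 2 * Real.pi * (c : ℝ) * (1 / 2) = c * Real.pi by ring, Real.sin_int_mul_pi]
    simp

lemma integral_cosSum (l : List ℤ) (c : ℤ) :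
    ∫ x in (0:ℝ)..(1/2), cosSum l c x = constCoeff l c / 2 := by
  induction l generalizing c with
  | nil => simp [cosSum, constCoeff]
  | cons a l ih =>
    simp only [cosSum, constCoeff]
    rw [intervalIntegral.integral_add (Continuous.intervalIntegrable (by fun_prop) _ _)
      ((continuous_cosSum l _).intervalIntegrable _ _), intervalIntegral.integral_const_mul,
      integral_cos_two_pi_int_mul, ih]
    split_ifs <;> push_cast <;> ring

lemma moments_getD (s : ℤ) (N : ℕ) (l : List ℤ) (c : ℤ) {n : ℕ} (hn : n < N) :
    ((moments s N l c).getD n 0 : ℝ) / 2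
      = ∫ x in (0:ℝ)..(1/2), (5 - (3 + 2 * (Real.cos (2 * Real.pi * x)
          + s * Real.cos (12 * Real.pi * x) + s * Real.cos (14 * Real.pi * x)))) ^ n
            * cosSum l c x := by
  induction N generalizing n l c with
  | zero => omega
  | succ N ih =>
    cases n with
    | zero => simp only [moments, List.getD_cons_zero, pow_zero, one_mul, integral_cosSum]
    | succ n =>
      simp only [moments, List.getD_cons_succ]
      rw [ih _ _ (by omega)]
      simp only [cosSum_stepList, pow_succ, mul_assoc]

/-- The integers `2 * 5 ^ n * momentDiff n`, `n < 40`. -/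
def momentTable : List ℤ :=
  [0, 0, 0, 0, 0, 0, 0, 28, -256, -288, -14760, -48840, -542784, -2136992, -16160144, -67413060,
   -422040320, -1790241440, -9982711440, -42073576896, -215460948480, -882984887960,
   -4177101303848, -16069149127284, -68345431982080, -223164335618400, -722508007917800,
   -722737900071720, 7500132272767680, 107185000190902920, 827332275134593800,
   5799782976554743800, 36308034134150378496, 220862154564636404160, 1282424532892787923232,
   7334141691824561009088, 40925460847968264961536, 226090721218686776216952,
   1230638724887004117998952, 6649704829912099318795276]

lemma moments_sub_eq_momentTable :
    addList (moments (-1) 40 [1] 0) (scaleList (-1) (moments 1 40 [1] 0)) = momentTable := by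
  decide +kernel

lemma getD_addList (l m : List ℤ) (n : ℕ) :
    (addList l m).getD n 0 = l.getD n 0 + m.getD n 0 := by
  induction l generalizing m n with
  | nil => simp [addList]
  | cons a l ih =>
    cases m with
    | nil => simp [addList]
    | cons b m =>
      cases n with
      | zero => simp [addList]
      | succ n => simpa [addList] using ih m n

lemma getD_scaleList (c : ℤ) (l : List ℤ) (n : ℕ) :
    (scaleList c l).getD n 0 = c * l.getD n 0 := by
  induction l generalizing n with
  | nil => simp [scaleList]
  | cons a l ih =>
    cases n with
    | zero => simp [scaleList]
    | succ n => simpa [scaleList] using ih n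

lemma momentDiff_eq {n : ℕ} (hn : n < 40) :
    momentDiff n = (momentTable.getD n 0 : ℝ) * (1 / 2 * (1 / 5) ^ n) := by
  have hm := moments_getD (-1) 40 [1] 0 hn
  have hp := moments_getD 1 40 [1] 0 hn
  have key : ∀ g : ℝ → ℝ, ∫ x in (0:ℝ)..(1/2), (1 - g x / 5) ^ n
      = (∫ x in (0:ℝ)..(1/2), (5 - g x) ^ n) * (1 / 5) ^ n := by
    intro g
    rw [← intervalIntegral.integral_mul_const]
    congr 1
    ext x
    rw [← mul_pow]
    ring
  rw [momentDiff, key, key, ← moments_sub_eq_momentTable, getD_addList, getD_scaleList]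
  have hm' : ∫ x in (0:ℝ)..(1/2), (5 - Gm x) ^ n
      = ((moments (-1) 40 [1] 0).getD n 0 : ℝ) / 2 := by
    rw [hm]
    simp [cosSum, Gm, sub_eq_add_neg]
  have hp' : ∫ x in (0:ℝ)..(1/2), (5 - Gp x) ^ n
      = ((moments 1 40 [1] 0).getD n 0 : ℝ) / 2 := by
    rw [hp]
    simp [cosSum, Gp]
  rw [hm', hp']
  push_cast
  ring

/-! ### Polynomial bounds in the variable `10 (t - 5.23)` -/

/-- Evaluation of a polynomial given by its list of coefficients. -/
noncomputable def polyEval : List ℚ → ℝ → ℝ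
  | [], _ => 0
  | a :: l, x => a + x * polyEval l x

/-- Multiplication of a polynomial by `c + e X`. -/
def mulLin (c e : ℚ) (l : List ℚ) : List ℚ := addList (scaleList c l) (0 :: scaleList e l)

/-- `∑ n, ms[n] * binTail k t n` as a polynomial in `y`, where `t = 523 / 100 + y / 10`. -/
def binPoly : ℕ → List ℚ → List ℚ
  | _, [] => []
  | k, m :: ms =>
    addList [m] (mulLin ((k - 523 / 100) / (k + 1)) (-1 / (10 * (k + 1))) (binPoly (k + 1) ms))

/-- The derivative of a polynomial. -/
def derivList : List ℚ → List ℚ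
  | [] => []
  | _ :: l => addList l (0 :: derivList l)

/-- The sum of the absolute values of the coefficients. -/
def coeffNorm : List ℚ → ℚ
  | [] => 0
  | a :: l => |a| + coeffNorm l

/-- A lower bound for a polynomial on `[-1, 1]`. -/
def polyLower : List ℚ → ℚ
  | [] => 0
  | a :: l => a - coeffNorm l

/-- The `n`-th entry multiplied by `c / 5 ^ n`. -/
def geomScale : ℚ → List ℤ → List ℚ
  | _, [] => []
  | c, a :: l => a * c :: geomScale (c / 5) l

lemma polyEval_addList (l m : List ℚ) (x : ℝ) :
    polyEval (addList l m) x = polyEval l x + polyEval m x := by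
  induction l generalizing m with
  | nil => simp [addList, polyEval]
  | cons a l ih =>
    cases m with
    | nil => simp [addList, polyEval]
    | cons b m =>
      simp only [addList, polyEval, ih]
      push_cast
      ring

lemma polyEval_scaleList (c : ℚ) (l : List ℚ) (x : ℝ) :
    polyEval (scaleList c l) x = c * polyEval l x := by
  induction l with
  | nil => simp [scaleList, polyEval]
  | cons a l ih =>
    simp only [scaleList] at ih
    simp only [scaleList, List.map_cons, polyEval, ih]
    push_cast
    ring

lemma polyEval_mulLin (c e : ℚ) (l : List ℚ) (x : ℝ) :
    polyEval (mulLin c e l) x = (c + e * x) * polyEval l x := by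
  simp only [mulLin, polyEval_addList, polyEval_scaleList, polyEval]
  push_cast
  ring

lemma polyEval_binPoly (k : ℕ) (ms : List ℚ) (t : ℝ) :
    polyEval (binPoly k ms) (10 * (t - 523 / 100))
      = ∑ n ∈ Finset.range ms.length, (ms.getD n 0 : ℝ) * binTail k t n := by
  induction ms generalizing k with
  | nil => simp [binPoly, polyEval]
  | cons m ms ih =>
    have hk : (k : ℝ) + 1 ≠ 0 := by positivity
    rw [List.length_cons, Finset.sum_range_succ']
    simp only [binPoly, polyEval_addList, polyEval_mulLin, polyEval, ih, binTail_succ',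
      List.getD_cons_succ, List.getD_cons_zero]
    rw [Finset.mul_sum, add_comm]
    congr 1
    · refine Finset.sum_congr rfl fun n _ => ?_
      push_cast
      field_simp
      ring
    · simp [binTail]

lemma hasDerivAt_polyEval (l : List ℚ) (x : ℝ) :
    HasDerivAt (polyEval l) (polyEval (derivList l) x) x := by
  induction l with
  | nil => exact hasDerivAt_const x 0
  | cons a l ih =>
    have h := ((hasDerivAt_id x).mul ih).const_add (a : ℝ)
    simp only [derivList, polyEval_addList, polyEval]
    exact h.congr_deriv (by simp)

lemma abs_polyEval_le (l : List ℚ) {x : ℝ} (hx : |x| ≤ 1) : |polyEval l x| ≤ coeffNorm l := by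
  induction l with
  | nil => simp [polyEval, coeffNorm]
  | cons a l ih =>
    simp only [polyEval, coeffNorm]
    push_cast
    refine (abs_add_le _ _).trans (add_le_add le_rfl ?_)
    rw [abs_mul]
    exact (mul_le_of_le_one_left (abs_nonneg _) hx).trans ih

lemma polyLower_le (l : List ℚ) {x : ℝ} (hx : |x| ≤ 1) : (polyLower l : ℝ) ≤ polyEval l x := by
  cases l with
  | nil => simp [polyEval, polyLower]
  | cons a l =>
    have h : |x * polyEval l x| ≤ coeffNorm l := by
      rw [abs_mul]
      exact (mul_le_of_le_one_left (abs_nonneg _) hx).trans (abs_polyEval_le l hx)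
    simp only [polyEval, polyLower]
    push_cast
    linarith [(abs_le.1 h).1]

lemma length_geomScale (c : ℚ) (l : List ℤ) : (geomScale c l).length = l.length := by
  induction l generalizing c with
  | nil => rfl
  | cons a l ih => simp [geomScale, ih]

lemma getD_geomScale (c : ℚ) (l : List ℤ) (n : ℕ) :
    (geomScale c l).getD n 0 = l.getD n 0 * (c * (1 / 5) ^ n) := by
  induction l generalizing c n with
  | nil => simp [geomScale]
  | cons a l ih =>
    cases n with
    | zero => simp [geomScale]
    | succ n =>
      simp only [geomScale, List.getD_cons_succ, ih, pow_succ]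
      ring

/-- The first `40` terms of the series for `d t / 5 ^ t`. -/
def mainPoly : List ℚ := binPoly 0 (geomScale (1 / 2) momentTable)

/-- `binTail 0 t 40`. -/
def lastPoly : List ℚ := binPoly 0 (List.replicate 40 0 ++ [1])

lemma polyEval_mainPoly (t : ℝ) :
    polyEval mainPoly (10 * (t - 523 / 100))
      = ∑ n ∈ Finset.range 40, momentDiff n * binTail 0 t n := by
  rw [mainPoly, polyEval_binPoly, length_geomScale]
  refine Finset.sum_congr rfl fun n hn => ?_
  rw [momentDiff_eq (Finset.mem_range.1 hn), getD_geomScale]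
  push_cast
  ring

lemma polyEval_lastPoly (t : ℝ) :
    polyEval lastPoly (10 * (t - 523 / 100)) = binTail 0 t 40 := by
  rw [lastPoly, polyEval_binPoly, List.length_append, List.length_replicate, List.length_singleton,
    Finset.sum_range_succ, Finset.sum_eq_zero, zero_add]
  · simp
  · intro n hn
    rw [List.getD_append _ _ _ _ (by simpa using hn), List.getD_replicate _ (Finset.mem_range.1 hn)]
    simp

lemma lastPoly_le_mainPoly : coeffNorm lastPoly * 8 ≤ polyLower mainPoly := by
  decide +kernel

lemma deriv_lastPoly_lt_deriv_mainPoly :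
    10 * coeffNorm (derivList lastPoly) * 8 + coeffNorm lastPoly * 10
      < 10 * polyLower (derivList mainPoly) := by
  decide +kernel

theorem stmt13 : ∀ t : ℝ, 5.13 ≤ t → t ≤ 5.33 → 0 < deriv d t := by
  intro t ht1 ht2
  have hy : |10 * (t - 523 / 100)| ≤ 1 := by
    norm_num at ht1 ht2
    rw [abs_le]
    constructor <;> linarith
  have hQ : |tailSum 40 t| ≤ 8 := by
    refine (abs_tailSum_le (s := 5) (by norm_num) (by linarith) (by norm_num; linarith)).trans ?_
    norm_num
  obtain ⟨q, hq, hq'⟩ := exists_hasDerivAt_tailSum (K := 40) (s := 4) (t := t) (by norm_num)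
    (by linarith) (by norm_num; linarith)
  replace hq : |q| ≤ 10 := hq.trans (by norm_num)
  have hlin : HasDerivAt (fun s : ℝ => 10 * (s - 523 / 100)) 10 t := by
    simpa using ((hasDerivAt_id t).sub_const (523 / 100)).const_mul (10 : ℝ)
  have hA := (hasDerivAt_polyEval mainPoly _).comp t hlin
  have hB := (hasDerivAt_polyEval lastPoly _).comp t hlin
  have h5 : HasDerivAt (fun s : ℝ => (5 : ℝ) ^ s) (5 ^ t * Real.log 5) t :=
    Real.hasStrictDerivAt_const_rpow (by norm_num) t |>.hasDerivAt
  have hd := h5.mul (hA.add (hB.mul hq'))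
  have heq : d =ᶠ[nhds t] fun s => (5 : ℝ) ^ s * (polyEval mainPoly (10 * (s - 523 / 100))
      + polyEval lastPoly (10 * (s - 523 / 100)) * tailSum 40 s) := by
    filter_upwards [lt_mem_nhds (show (0 : ℝ) < t by linarith)] with s hs
    rw [polyEval_mainPoly, polyEval_lastPoly]
    exact d_eq 40 hs
  rw [(hd.congr_of_eventuallyEq heq).deriv]
  have hA0 := polyLower_le mainPoly hy
  have hA1 := polyLower_le (derivList mainPoly) hy
  have hB0 := abs_polyEval_le lastPoly hy
  have hB1 := abs_polyEval_le (derivList lastPoly) hy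
  have c0 : (coeffNorm lastPoly : ℝ) * 8 ≤ polyLower mainPoly := by
    exact_mod_cast lastPoly_le_mainPoly
  have c1 : 10 * (coeffNorm (derivList lastPoly) : ℝ) * 8 + coeffNorm lastPoly * 10
      < 10 * polyLower (derivList mainPoly) := by
    exact_mod_cast deriv_lastPoly_lt_deriv_mainPoly
  simp only [Function.comp_apply, Pi.add_apply, Pi.mul_apply]
  set y := 10 * (t - 523 / 100)
  have e0 : |polyEval lastPoly y * tailSum 40 t| ≤ coeffNorm lastPoly * 8 := by
    rw [abs_mul]; exact mul_le_mul hB0 hQ (abs_nonneg _) ((abs_nonneg _).trans hB0)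
  have e1 : |polyEval (derivList lastPoly) y * tailSum 40 t|
      ≤ coeffNorm (derivList lastPoly) * 8 := by
    rw [abs_mul]; exact mul_le_mul hB1 hQ (abs_nonneg _) ((abs_nonneg _).trans hB1)
  have e2 : |polyEval lastPoly y * q| ≤ coeffNorm lastPoly * 10 := by
    rw [abs_mul]; exact mul_le_mul hB0 hq (abs_nonneg _) ((abs_nonneg _).trans hB0)
  have s0 : 0 ≤ polyEval mainPoly y + polyEval lastPoly y * tailSum 40 t := by
    linarith [(abs_le.1 e0).1]
  have s1 : 0 < polyEval (derivList mainPoly) y * 10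
      + (polyEval (derivList lastPoly) y * 10 * tailSum 40 t + polyEval lastPoly y * q) := by
    linarith [(abs_le.1 e1).1, (abs_le.1 e2).1]
  have hlog : 0 < Real.log 5 := Real.log_pos (by norm_num)
  positivity
end

section
/- Let G be either G_+ or G_− (with k = 5) and let t ≥ 1. Then the total variation over one period of the function G^t · G' satisfies Var(G^t G') ≤ 176 · Var(G^t) + 3400 · √( ∫_𝕋 G^{2t} ). -/
open MeasureTheory

open Set Filter Topology

/-- The variation of a `C¹` function is at most the integral of the absolute value of its
derivative. -/
theorem eVariationOn_le_integral_abs_deriv {f f' : ℝ → ℝ} {a b : ℝ}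
    (hf : ∀ x, HasDerivAt f (f' x) x) (hf' : Continuous f') :
    eVariationOn f (Icc a b) ≤ ENNReal.ofReal (∫ x in a..b, |f' x|) := by
  have hint : ∀ c d, IntervalIntegrable (fun x => |f' x|) volume c d :=
    fun c d => hf'.abs.intervalIntegrable c d
  refine iSup_le fun ⟨n, u, hu, hus⟩ => ?_
  have hstep : ∀ i, edist (f (u (i + 1))) (f (u i)) ≤
      ENNReal.ofReal (∫ x in (u i)..(u (i + 1)), |f' x|) := by
    intro i
    rw [edist_dist, Real.dist_eq, ← intervalIntegral.integral_eq_sub_of_hasDerivAt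
      (fun x _ => hf x) (hf'.intervalIntegrable _ _)]
    exact ENNReal.ofReal_le_ofReal
      (intervalIntegral.abs_integral_le_integral_abs (hu (Nat.le_succ i)))
  calc ∑ i ∈ Finset.range n, edist (f (u (i + 1))) (f (u i))
      ≤ ∑ i ∈ Finset.range n, ENNReal.ofReal (∫ x in (u i)..(u (i + 1)), |f' x|) :=
        Finset.sum_le_sum fun i _ => hstep i
    _ = ENNReal.ofReal (∫ x in (u 0)..(u n), |f' x|) := by
        rw [← ENNReal.ofReal_sum_of_nonneg fun i _ =>
          intervalIntegral.integral_nonneg (hu (Nat.le_succ i)) fun x _ => abs_nonneg _,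
          intervalIntegral.sum_integral_adjacent_intervals fun k _ => hint _ _]
    _ ≤ ENNReal.ofReal (∫ x in a..b, |f' x|) :=
        ENNReal.ofReal_le_ofReal <| intervalIntegral.integral_mono_interval (hus 0).1
          (hu (Nat.zero_le n)) (hus n).2 (Eventually.of_forall fun x => abs_nonneg _) (hint a b)

/-- The integral of the absolute value of the derivative of a function of bounded variation is at
most its variation. -/
theorem integral_abs_deriv_le_toReal_eVariationOn {f f' : ℝ → ℝ} {a b : ℝ} (hab : a ≤ b)
    (hf : ∀ x, HasDerivAt f (f' x) x) (hf' : Continuous f')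
    (hbv : BoundedVariationOn f (Icc a b)) :
    ∫ x in a..b, |f' x| ≤ (eVariationOn f (Icc a b)).toReal := by
  have hloc := hbv.locallyBoundedVariationOn
  have ha : a ∈ Icc a b := left_mem_Icc.2 hab
  set V := variationOnFromTo f (Icc a b) a with hV
  have hmono : MonotoneOn V (Icc a b) := variationOnFromTo.monotoneOn hloc ha
  have hmono' : MonotoneOn V (uIcc a b) := by rwa [uIcc_of_le hab]
  have hle : ∀ᵐ x ∂volume.restrict (Icc a b), |f' x| ≤ deriv V x := by
    rw [← restrict_Ioo_eq_restrict_Icc, ae_restrict_iff' measurableSet_Ioo]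
    filter_upwards [hmono.ae_differentiableWithinAt_of_mem] with x hx hxab
    have hnhds : Icc a b ∈ 𝓝 x := Icc_mem_nhds hxab.1 hxab.2
    have hVx : HasDerivAt V (deriv V x) x :=
      ((hx (Ioo_subset_Icc_self hxab)).differentiableAt hnhds).hasDerivAt
    have hadd : 0 ≤ deriv V x + f' x := by
      rw [← (hVx.add (hf x)).deriv, ← derivWithin_of_mem_nhds hnhds]
      exact (variationOnFromTo.add_self_monotoneOn hloc ha).derivWithin_nonneg
    have hsub : 0 ≤ deriv V x - f' x := by
      rw [← (hVx.sub (hf x)).deriv, ← derivWithin_of_mem_nhds hnhds]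
      exact (variationOnFromTo.sub_self_monotoneOn hloc ha).derivWithin_nonneg
    exact abs_le.2 ⟨by linarith, by linarith⟩
  have hVab : V a ≤ V b := hmono ha (right_mem_Icc.2 hab) hab
  have hmem := hmono'.intervalIntegral_deriv_mem_uIcc
  rw [uIcc_of_le (sub_nonneg.2 hVab)] at hmem
  calc ∫ x in a..b, |f' x| ≤ ∫ x in a..b, deriv V x :=
        intervalIntegral.integral_mono_ae_restrict hab (hf'.abs.intervalIntegrable _ _)
          hmono'.intervalIntegrable_deriv hle
    _ ≤ V b - V a := hmem.2
    _ ≤ (eVariationOn f (Icc a b)).toReal := by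
        rw [hV, variationOnFromTo.self, sub_zero]
        exact (le_abs_self _).trans (variationOnFromTo.abs_le_eVariationOn hbv)

/-- The variation of a product of `C¹` functions, one of which is bounded by `M`. -/
theorem eVariationOn_mul_le_add_integral {f f' g g' : ℝ → ℝ} {a b M : ℝ} (hab : a ≤ b)
    (hM : 0 < M) (hgM : ∀ x, |g x| ≤ M)
    (hf : ∀ x, HasDerivAt f (f' x) x) (hf' : Continuous f')
    (hg : ∀ x, HasDerivAt g (g' x) x) (hg' : Continuous g') :
    eVariationOn (fun x => f x * g x) (Icc a b) ≤
      ENNReal.ofReal M * eVariationOn f (Icc a b) +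
        ENNReal.ofReal (∫ x in a..b, |f x| * |g' x|) := by
  by_cases hbv : eVariationOn f (Icc a b) = ⊤
  · rw [hbv, ENNReal.mul_top (ENNReal.ofReal_pos.2 hM).ne', top_add]
    exact le_top
  have hfc : Continuous f := continuous_iff_continuousAt.2 fun x => (hf x).continuousAt
  have hgc : Continuous g := continuous_iff_continuousAt.2 fun x => (hg x).continuousAt
  have hint : ∫ x in a..b, |f' x * g x + f x * g' x| ≤
      M * (∫ x in a..b, |f' x|) + ∫ x in a..b, |f x| * |g' x| := by
    rw [← intervalIntegral.integral_const_mul, ← intervalIntegral.integral_add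
      (Continuous.intervalIntegrable (by fun_prop) _ _)
      (Continuous.intervalIntegrable (by fun_prop) _ _)]
    refine intervalIntegral.integral_mono_on hab
      (Continuous.intervalIntegrable (by fun_prop) _ _)
      (Continuous.intervalIntegrable (by fun_prop) _ _) fun x _ => ?_
    refine (abs_add_le _ _).trans ?_
    rw [abs_mul, abs_mul, mul_comm |f' x|]
    gcongr
    exact hgM x
  calc eVariationOn (fun x => f x * g x) (Icc a b)
      ≤ ENNReal.ofReal (∫ x in a..b, |f' x * g x + f x * g' x|) :=
        eVariationOn_le_integral_abs_deriv (fun x => (hf x).mul (hg x)) (by fun_prop)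
    _ ≤ ENNReal.ofReal (M * (eVariationOn f (Icc a b)).toReal +
          ∫ x in a..b, |f x| * |g' x|) := by
        refine ENNReal.ofReal_le_ofReal (hint.trans ?_)
        gcongr
        exact integral_abs_deriv_le_toReal_eVariationOn hab hf hf' hbv
    _ ≤ _ := by
        refine ENNReal.ofReal_add_le.trans ?_
        rw [ENNReal.ofReal_mul hM.le, ENNReal.ofReal_toReal hbv]

/-- The Cauchy–Schwarz inequality for integrals of continuous functions over an interval. -/
theorem integral_mul_le_sqrt_mul_sqrt {u v : ℝ → ℝ} {a b : ℝ} (hab : a ≤ b)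
    (hu : Continuous u) (hv : Continuous v) :
    ∫ x in a..b, u x * v x ≤ √(∫ x in a..b, u x ^ 2) * √(∫ x in a..b, v x ^ 2) := by
  have hquad : ∀ c : ℝ, 0 ≤ (∫ x in a..b, v x ^ 2) * (c * c) +
      (-2 * ∫ x in a..b, u x * v x) * c + ∫ x in a..b, u x ^ 2 := by
    intro c
    have h : 0 ≤ ∫ x in a..b, (c * c * v x ^ 2 + (-2 * c) * (u x * v x) + u x ^ 2) :=
      intervalIntegral.integral_nonneg hab fun x _ => by nlinarith [sq_nonneg (c * v x - u x)]
    rw [intervalIntegral.integral_add (Continuous.intervalIntegrable (by fun_prop) _ _)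
      (Continuous.intervalIntegrable (by fun_prop) _ _),
      intervalIntegral.integral_add (Continuous.intervalIntegrable (by fun_prop) _ _)
      (Continuous.intervalIntegrable (by fun_prop) _ _),
      intervalIntegral.integral_const_mul, intervalIntegral.integral_const_mul] at h
    linarith
  have hdisc := discrim_le_zero hquad
  rw [discrim] at hdisc
  rw [← Real.sqrt_mul (intervalIntegral.integral_nonneg hab fun x _ => sq_nonneg _)]
  exact Real.le_sqrt_of_sq_le (by linarith)

theorem integral_cos_two_pi_nat_mul {m : ℕ} (hm : m ≠ 0) :
    ∫ x in (-(1:ℝ)/2)..(1/2), Real.cos (2 * m * Real.pi * x) = 0 := by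
  have hc : 2 * (m : ℝ) * Real.pi ≠ 0 := by positivity
  rw [intervalIntegral.integral_comp_mul_left _ hc, integral_cos,
    show 2 * (m : ℝ) * Real.pi * (1 / 2) = m * Real.pi by ring,
    show 2 * (m : ℝ) * Real.pi * (-1 / 2) = -(m * Real.pi) by ring, Real.sin_neg,
    Real.sin_nat_mul_pi]
  simp

section

variable (s : ℝ)

/-- The common form of `Gp` (`s = 1`) and `Gm` (`s = -1`). -/
noncomputable def Gsign (x : ℝ) : ℝ :=
  3 + 2 * (Real.cos (2 * Real.pi * x) + s * Real.cos (12 * Real.pi * x) +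
    s * Real.cos (14 * Real.pi * x))

/-- The derivative of `Gsign`. -/
noncomputable def Gsign' (x : ℝ) : ℝ :=
  -(4 * Real.pi) * (Real.sin (2 * Real.pi * x) + 6 * s * Real.sin (12 * Real.pi * x) +
    7 * s * Real.sin (14 * Real.pi * x))

/-- The second derivative of `Gsign`. -/
noncomputable def Gsign'' (x : ℝ) : ℝ :=
  -(8 * Real.pi ^ 2) * (Real.cos (2 * Real.pi * x) + 36 * s * Real.cos (12 * Real.pi * x) +
    49 * s * Real.cos (14 * Real.pi * x))

theorem continuous_Gsign : Continuous (Gsign s) := by unfold Gsign; fun_prop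

theorem continuous_Gsign' : Continuous (Gsign' s) := by unfold Gsign'; fun_prop

theorem continuous_Gsign'' : Continuous (Gsign'' s) := by unfold Gsign''; fun_prop

theorem hasDerivAt_Gsign (x : ℝ) : HasDerivAt (Gsign s) (Gsign' s x) x := by
  have h (c : ℝ) : HasDerivAt (fun y => Real.cos (c * y)) (-Real.sin (c * x) * c) x := by
    simpa using ((hasDerivAt_id x).const_mul c).cos
  convert! ((((h (2 * Real.pi)).add ((h (12 * Real.pi)).const_mul s)).add
    ((h (14 * Real.pi)).const_mul s)).const_mul 2).const_add 3 using 1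
  rw [Gsign']
  ring

theorem hasDerivAt_Gsign' (x : ℝ) : HasDerivAt (Gsign' s) (Gsign'' s x) x := by
  have h (c : ℝ) : HasDerivAt (fun y => Real.sin (c * y)) (Real.cos (c * x) * c) x := by
    simpa using ((hasDerivAt_id x).const_mul c).sin
  convert! (((h (2 * Real.pi)).add ((h (12 * Real.pi)).const_mul (6 * s))).add
    ((h (14 * Real.pi)).const_mul (7 * s))).const_mul (-(4 * Real.pi)) using 1
  rw [Gsign'']
  ring

variable {s}

theorem Gsign_nonneg (hs : s ^ 2 = 1) (x : ℝ) : 0 ≤ Gsign s x := by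
  have h12 := Real.cos_sub (14 * Real.pi * x) (2 * Real.pi * x)
  rw [show 14 * Real.pi * x - 2 * Real.pi * x = 12 * Real.pi * x by ring] at h12
  have h : Gsign s x = (1 + Real.cos (2 * Real.pi * x) + s * Real.cos (14 * Real.pi * x)) ^ 2 +
      (Real.sin (2 * Real.pi * x) + s * Real.sin (14 * Real.pi * x)) ^ 2 := by
    rw [Gsign, h12]
    linear_combination -Real.sin_sq_add_cos_sq (2 * Real.pi * x) -
      s ^ 2 * Real.sin_sq_add_cos_sq (14 * Real.pi * x) - hs
  rw [h]
  positivity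

theorem abs_Gsign'_le (hs : |s| = 1) (x : ℝ) : |Gsign' s x| ≤ 176 := by
  have hsum : |Real.sin (2 * Real.pi * x) + 6 * s * Real.sin (12 * Real.pi * x) +
      7 * s * Real.sin (14 * Real.pi * x)| ≤ 14 := by
    refine (abs_add_three _ _ _).trans ?_
    simp only [abs_mul, hs, Nat.abs_ofNat]
    linarith [Real.abs_sin_le_one (2 * Real.pi * x), Real.abs_sin_le_one (12 * Real.pi * x),
      Real.abs_sin_le_one (14 * Real.pi * x)]
  rw [Gsign', abs_mul, abs_neg, abs_of_pos (by positivity)]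
  nlinarith [Real.pi_lt_d4, Real.pi_pos]

theorem Gsign''_sq (hs : s ^ 2 = 1) (x : ℝ) :
    Gsign'' s x ^ 2 = 64 * Real.pi ^ 4 * (1849 + (1764 * Real.cos (2 * (1 : ℕ) * Real.pi * x) +
      1 / 2 * Real.cos (2 * (2 : ℕ) * Real.pi * x) +
      36 * s * Real.cos (2 * (5 : ℕ) * Real.pi * x) +
      49 * s * Real.cos (2 * (6 : ℕ) * Real.pi * x) +
      36 * s * Real.cos (2 * (7 : ℕ) * Real.pi * x) +
      49 * s * Real.cos (2 * (8 : ℕ) * Real.pi * x) +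
      648 * Real.cos (2 * (12 : ℕ) * Real.pi * x) +
      1764 * Real.cos (2 * (13 : ℕ) * Real.pi * x) +
      2401 / 2 * Real.cos (2 * (14 : ℕ) * Real.pi * x))) := by
  have key (p q : ℝ) : Real.cos p * Real.cos q = (Real.cos (p - q) + Real.cos (p + q)) / 2 := by
    rw [Real.cos_sub, Real.cos_add]
    ring
  have h11 := key (2 * Real.pi * x) (2 * Real.pi * x)
  have h66 := key (12 * Real.pi * x) (12 * Real.pi * x)
  have h77 := key (14 * Real.pi * x) (14 * Real.pi * x)
  have h61 := key (12 * Real.pi * x) (2 * Real.pi * x)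
  have h71 := key (14 * Real.pi * x) (2 * Real.pi * x)
  have h76 := key (14 * Real.pi * x) (12 * Real.pi * x)
  rw [sub_self, Real.cos_zero] at h11 h66 h77
  rw [Gsign'']
  push_cast
  ring_nf at h11 h66 h77 h61 h71 h76 ⊢
  linear_combination 64 * Real.pi ^ 4 * (h11 + 1296 * s ^ 2 * h66 +
    2401 * s ^ 2 * h77 + 72 * s * h61 + 98 * s * h71 + 3528 * s ^ 2 * h76) +
    64 * Real.pi ^ 4 * (3697 / 2 + 1764 * Real.cos (Real.pi * x * 2) +
    648 * Real.cos (Real.pi * x * 24) + 1764 * Real.cos (Real.pi * x * 26) +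
    2401 / 2 * Real.cos (Real.pi * x * 28)) * hs

theorem integral_Gsign''_sq (hs : s ^ 2 = 1) :
    ∫ x in (-(1:ℝ)/2)..(1/2), Gsign'' s x ^ 2 = (344 * Real.pi ^ 2) ^ 2 := by
  simp only [Gsign''_sq hs]
  have hcos {m : ℕ} (c : ℝ) (hm : m ≠ 0) :
      ∫ x in (-(1:ℝ)/2)..(1/2), c * Real.cos (2 * m * Real.pi * x) = 0 := by
    rw [intervalIntegral.integral_const_mul, integral_cos_two_pi_nat_mul hm, mul_zero]
  rw [intervalIntegral.integral_const_mul]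
  repeat rw [intervalIntegral.integral_add (Continuous.intervalIntegrable (by fun_prop) _ _)
    (Continuous.intervalIntegrable (by fun_prop) _ _)]
  simp only [hcos _ (Nat.succ_ne_zero _), intervalIntegral.integral_const]
  norm_num
  ring

theorem eVariationOn_Gsign_rpow_mul_deriv_le (hs : |s| = 1) {t : ℝ} (ht : 1 ≤ t) :
    eVariationOn (fun x => Gsign s x ^ t * deriv (Gsign s) x) (Icc (-(1:ℝ)/2) (1/2)) ≤
      176 * eVariationOn (fun x => Gsign s x ^ t) (Icc (-(1:ℝ)/2) (1/2)) +
        ENNReal.ofReal (3400 * √(∫ x in (-(1:ℝ)/2)..(1/2), Gsign s x ^ (2 * t))) := by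
  have hs2 : s ^ 2 = 1 := by rw [← sq_abs, hs, one_pow]
  have hcont : Continuous fun x => Gsign s x ^ t :=
    (continuous_Gsign s).rpow_const fun x => Or.inr (by linarith)
  have hcont' : Continuous fun x => Gsign' s x * t * Gsign s x ^ (t - 1) :=
    ((continuous_Gsign' s).mul continuous_const).mul
      ((continuous_Gsign s).rpow_const fun x => Or.inr (by linarith))
  have hmul := eVariationOn_mul_le_add_integral (a := -(1:ℝ)/2) (b := 1/2) (by norm_num)
    (by norm_num) (abs_Gsign'_le hs) (fun x => (hasDerivAt_Gsign s x).rpow_const (Or.inr ht))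
    hcont' (hasDerivAt_Gsign' s) (continuous_Gsign'' s)
  have hcs := integral_mul_le_sqrt_mul_sqrt (a := -(1:ℝ)/2) (b := 1/2) (by norm_num)
    hcont.abs (continuous_Gsign'' s).abs
  have hpow (x : ℝ) : (Gsign s x ^ t) ^ 2 = Gsign s x ^ (2 * t) := by
    rw [← Real.rpow_mul_natCast (Gsign_nonneg hs2 x), mul_comm t, Nat.cast_ofNat]
  simp only [sq_abs, integral_Gsign''_sq hs2, hpow] at hcs
  rw [Real.sqrt_sq (by positivity)] at hcs
  simp only [(hasDerivAt_Gsign s _).deriv]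
  refine hmul.trans (add_le_add (by simp) (ENNReal.ofReal_le_ofReal (hcs.trans ?_)))
  rw [mul_comm]
  gcongr
  nlinarith [Real.pi_lt_d4, Real.pi_pos]

end

theorem stmt17 (G : ℝ → ℝ) (hG : G = Gp ∨ G = Gm) (t : ℝ) (ht : 1 ≤ t) :
    eVariationOn (fun x => G x ^ t * deriv G x) (Set.Icc (-(1:ℝ)/2) (1/2)) ≤
      176 * eVariationOn (fun x => G x ^ t) (Set.Icc (-(1:ℝ)/2) (1/2)) +
        ENNReal.ofReal (3400 * Real.sqrt (∫ x in (-(1:ℝ)/2)..(1/2), G x ^ (2 * t))) := by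
  rcases hG with rfl | rfl
  · have h : Gp = Gsign 1 := by
      funext x
      simp only [Gp, Gsign]
      ring
    rw [h]
    exact eVariationOn_Gsign_rpow_mul_deriv_le (by simp) ht
  · have h : Gm = Gsign (-1) := by
      funext x
      simp only [Gm, Gsign]
      ring
    rw [h]
    exact eVariationOn_Gsign_rpow_mul_deriv_le (by simp) ht
end

section
/- Let G be either G_+ or G_− (with k = 5) and let X := { x : G(x) ≤ 1/9 } and χ_X its indicator function. Then the total variation over one period of G' · χ_X satisfies Var(G' χ_X) ≤ Var(G') ≤ √( ∫_𝕋 (G'')² ) < 3400; moreover ∫_𝕋 |G'| χ_X ≤ 14/9. -/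
open MeasureTheory

/-- A component of `{x ∈ [a, b] | t < G x}` contains a critical point of `G`, provided the
endpoints of `[a, b]` are critical. -/
lemma exists_deriv_eq_zero_mem_connectedComponentIn {G : ℝ → ℝ} (hG : Continuous G) {a b t : ℝ}
    (ha : deriv G a = 0) (hb : deriv G b = 0) {y : ℝ} (hy : y ∈ {x ∈ Set.Icc a b | t < G x}) :
    ∃ z ∈ connectedComponentIn {x ∈ Set.Icc a b | t < G x} y, deriv G z = 0 := by
  set S := {x ∈ Set.Icc a b | t < G x} with hS
  set C := connectedComponentIn S y with hC
  have hyC : y ∈ C := mem_connectedComponentIn hy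
  have hCS : C ⊆ S := connectedComponentIn_subset S y
  have hCI : closure C ⊆ Set.Icc a b :=
    closure_minimal (fun x hx => (hCS hx).1) isClosed_Icc
  have hcomp : IsCompact (closure C) := isCompact_Icc.of_isClosed_subset isClosed_closure hCI
  obtain ⟨z, hz, hmax⟩ :=
    hcomp.exists_isMaxOn ⟨y, subset_closure hyC⟩ hG.continuousOn
  have hzt : t < G z := hy.2.trans_le (hmax (subset_closure hyC))
  have hpre : IsPreconnected C := isPreconnected_connectedComponentIn
  have hzC : z ∈ C := by
    have h : IsPreconnected (insert z C) :=
      hpre.subset_closure (Set.subset_insert _ _) (Set.insert_subset hz subset_closure)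
    exact h.subset_connectedComponentIn (Set.mem_insert_of_mem _ hyC)
      (Set.insert_subset (show z ∈ S from ⟨hCI hz, hzt⟩) hCS) (Set.mem_insert _ _)
  refine ⟨z, hzC, ?_⟩
  rcases eq_or_lt_of_le (hCI hz).1 with rfl | haz
  · exact ha
  rcases eq_or_lt_of_le (hCI hz).2 with rfl | hzb
  · exact hb
  have hU : Set.Ioo a b ∩ {x | t < G x} ∈ nhds z :=
    Filter.inter_mem (Ioo_mem_nhds haz hzb) ((isOpen_lt continuous_const hG).mem_nhds hzt)
  obtain ⟨ε, hε, hball⟩ := Metric.mem_nhds_iff.1 hU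
  have hsub : C ∪ Metric.ball z ε ⊆ C := by
    have h : IsPreconnected (C ∪ Metric.ball z ε) :=
      hpre.union z hzC (Metric.mem_ball_self hε) (convex_ball z ε).isPreconnected
    exact h.subset_connectedComponentIn (Or.inl hyC) (Set.union_subset hCS fun x hx =>
      ⟨Set.Ioo_subset_Icc_self (hball hx).1, (hball hx).2⟩)
  have hloc : IsLocalMax G z := by
    filter_upwards [Metric.ball_mem_nhds z hε] with x hx
    exact hmax (subset_closure (hsub (Or.inr hx)))
  exact hloc.deriv_eq_zero

/-- Truncating `G'` to a sublevel set of `G` does not increase its variation, provided the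
endpoints of the interval are critical. -/
lemma eVariationOn_indicator_deriv_le {G : ℝ → ℝ} (hG : Continuous G) {a b : ℝ} (t : ℝ)
    (ha : deriv G a = 0) (hb : deriv G b = 0) :
    eVariationOn (Set.indicator {x | G x ≤ t} (deriv G)) (Set.Icc a b) ≤
      eVariationOn (deriv G) (Set.Icc a b) := by
  classical
  set S := {x ∈ Set.Icc a b | t < G x} with hS
  let pick : Set ℝ → ℝ := fun C => if h : ∃ z ∈ C, deriv G z = 0 then h.choose else 0
  have hpick : ∀ y ∈ S, pick (connectedComponentIn S y) ∈ connectedComponentIn S y ∧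
      deriv G (pick (connectedComponentIn S y)) = 0 := by
    intro y hy
    have h := exists_deriv_eq_zero_mem_connectedComponentIn hG ha hb hy
    have e : pick (connectedComponentIn S y) = h.choose := dif_pos h
    rw [e]
    exact h.choose_spec
  let φ : ℝ → ℝ := fun x => if x ∈ S then pick (connectedComponentIn S x) else x
  have hφS : ∀ x ∈ S, φ x = pick (connectedComponentIn S x) := fun x hx => if_pos hx
  have hφn : ∀ x ∉ S, φ x = x := fun x hx => if_neg hx
  have hord : ∀ y, (connectedComponentIn S y).OrdConnected := fun y =>
    isPreconnected_connectedComponentIn.ordConnected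
  have hmono : MonotoneOn φ (Set.Icc a b) := by
    intro x _ y _ hxy
    by_contra! hlt
    by_cases hxS : x ∈ S <;> by_cases hyS : y ∈ S
    · rw [hφS x hxS, hφS y hyS] at hlt
      have key : ∃ w, w ∈ connectedComponentIn S x ∧ w ∈ connectedComponentIn S y := by
        rcases le_total x (pick (connectedComponentIn S y)) with h | h
        · exact ⟨_, (hord x).out (mem_connectedComponentIn hxS) (hpick x hxS).1 ⟨h, hlt.le⟩,
            (hpick y hyS).1⟩
        · exact ⟨x, mem_connectedComponentIn hxS,
            (hord y).out (hpick y hyS).1 (mem_connectedComponentIn hyS) ⟨h, hxy⟩⟩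
      obtain ⟨w, hwx, hwy⟩ := key
      rw [connectedComponentIn_eq hwx, connectedComponentIn_eq hwy] at hlt
      exact lt_irrefl _ hlt
    · rw [hφS x hxS, hφn y hyS] at hlt
      exact hyS (connectedComponentIn_subset S x
        ((hord x).out (mem_connectedComponentIn hxS) (hpick x hxS).1 ⟨hxy, hlt.le⟩))
    · rw [hφS y hyS, hφn x hxS] at hlt
      exact hxS (connectedComponentIn_subset S y
        ((hord y).out (hpick y hyS).1 (mem_connectedComponentIn hyS) ⟨hlt.le, hxy⟩))
    · rw [hφn x hxS, hφn y hyS] at hlt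
      exact hxy.not_gt hlt
  have hmaps : Set.MapsTo φ (Set.Icc a b) (Set.Icc a b) := by
    intro x hx
    by_cases hxS : x ∈ S
    · rw [hφS x hxS]
      exact (connectedComponentIn_subset S x (hpick x hxS).1).1
    · rwa [hφn x hxS]
  have heq : Set.EqOn (Set.indicator {x | G x ≤ t} (deriv G)) (deriv G ∘ φ) (Set.Icc a b) := by
    intro x hx
    by_cases hxS : x ∈ S
    · rw [Function.comp_apply, hφS x hxS, (hpick x hxS).2, Set.indicator_of_notMem]
      exact not_le.2 hxS.2
    · rw [Function.comp_apply, hφn x hxS, Set.indicator_of_mem]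
      exact not_lt.1 fun h => hxS ⟨hx, h⟩
  rw [eVariationOn.congr heq]
  exact eVariationOn.comp_le_of_monotoneOn _ φ hmono hmaps

lemma eVariationOn_Icc_le_integral_abs {f f' : ℝ → ℝ} (hf : ∀ x, HasDerivAt f (f' x) x)
    (hc : Continuous f') (a b : ℝ) :
    eVariationOn f (Set.Icc a b) ≤ ENNReal.ofReal (∫ x in a..b, |f' x|) := by
  have hint : ∀ c d, IntervalIntegrable (fun x => |f' x|) volume c d := fun c d =>
    hc.abs.intervalIntegrable c d
  have hdist : ∀ c d, c ≤ d → |f d - f c| ≤ ∫ x in c..d, |f' x| := by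
    intro c d hcd
    rw [← intervalIntegral.integral_eq_sub_of_hasDerivAt (fun x _ => hf x)
      (hc.intervalIntegrable c d)]
    exact intervalIntegral.abs_integral_le_integral_abs hcd
  refine iSup_le fun ⟨n, u, hu, us⟩ => ?_
  calc ∑ i ∈ Finset.range n, edist (f (u (i + 1))) (f (u i))
      ≤ ∑ i ∈ Finset.range n, ENNReal.ofReal (∫ x in u i..u (i + 1), |f' x|) := by
        refine Finset.sum_le_sum fun i _ => ?_
        rw [edist_dist, Real.dist_eq]
        exact ENNReal.ofReal_le_ofReal (hdist _ _ (hu i.le_succ))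
    _ = ENNReal.ofReal (∫ x in u 0..u n, |f' x|) := by
        rw [← ENNReal.ofReal_sum_of_nonneg, intervalIntegral.sum_integral_adjacent_intervals]
        · exact fun k _ => hint _ _
        · exact fun i _ => intervalIntegral.integral_nonneg (hu i.le_succ) fun _ _ => abs_nonneg _
    _ ≤ ENNReal.ofReal (∫ x in a..b, |f' x|) := by
        refine ENNReal.ofReal_le_ofReal ?_
        exact intervalIntegral.integral_mono_interval (us 0).1 (hu n.zero_le) (us n).2
          (Filter.Eventually.of_forall fun _ => abs_nonneg _) (hint _ _)

lemma integral_abs_le_sqrt_integral_sq {h : ℝ → ℝ} (hc : Continuous h) {a b : ℝ}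
    (hab : b = a + 1) :
    ∫ x in a..b, |h x| ≤ Real.sqrt (∫ x in a..b, h x ^ 2) := by
  refine Real.le_sqrt_of_sq_le ?_
  set m := ∫ x in a..b, |h x| with hm
  have h0 : 0 ≤ ∫ x in a..b, (|h x| - m) ^ 2 :=
    intervalIntegral.integral_nonneg (by linarith) fun _ _ => sq_nonneg _
  have h1 : ∫ x in a..b, (|h x| - m) ^ 2 = (∫ x in a..b, h x ^ 2) - 2 * m * m + m ^ 2 := by
    have e : ∀ x, (|h x| - m) ^ 2 = h x ^ 2 - 2 * m * |h x| + m ^ 2 := fun x => by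
      rw [sub_sq, sq_abs]; ring
    simp only [e]
    rw [intervalIntegral.integral_add, intervalIntegral.integral_sub,
      intervalIntegral.integral_const_mul, ← hm, intervalIntegral.integral_const, hab]
    · simp
    all_goals exact Continuous.intervalIntegrable (by fun_prop) _ _
  nlinarith

/-- If `G ≥ 0` has at most `n` critical points in `(a, b)`, the integral of `|G'|` over the part
of `(a, b)` where `G ≤ t` is at most `(n + 1) t`. -/
lemma setLIntegral_abs_deriv_sublevel_le {G : ℝ → ℝ} (hG : Differentiable ℝ G)
    (h0 : ∀ x, 0 ≤ G x) (t : ℝ) (Z : Finset ℝ) (a b : ℝ)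
    (hZ : ∀ x ∈ Set.Ioo a b, deriv G x = 0 → x ∈ Z) :
    ∫⁻ x in Set.Ioo a b ∩ {x | G x ≤ t}, ENNReal.ofReal |deriv G x| ≤
      (Z.card + 1) * ENNReal.ofReal t := by
  classical
  induction hn : Z.card using Nat.strong_induction_on generalizing Z a b with
  | _ n ih =>
  by_cases hex : ∃ z ∈ Set.Ioo a b, z ∈ Z
  · obtain ⟨z, hz, hzZ⟩ := hex
    have hcard : (Z.filter (· < z)).card + (Z.filter (z < ·)).card + 1 ≤ n := by
      have hd : Disjoint (Z.filter (· < z)) (Z.filter (z < ·)) :=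
        Finset.disjoint_filter.2 fun x _ h h' => lt_asymm h h'
      rw [← Finset.card_union_of_disjoint hd, ← hn]
      refine Finset.card_lt_card ⟨?_, fun h => ?_⟩
      · exact Finset.union_subset (Finset.filter_subset _ _) (Finset.filter_subset _ _)
      · simpa using h hzZ
    have hl := ih _ (by omega) (Z.filter (· < z)) a z (fun x hx hx' =>
      Finset.mem_filter.2 ⟨hZ x ⟨hx.1, hx.2.trans hz.2⟩ hx', hx.2⟩) rfl
    have hr := ih _ (by omega) (Z.filter (z < ·)) z b (fun x hx hx' =>
      Finset.mem_filter.2 ⟨hZ x ⟨hz.1.trans hx.1, hx.2⟩ hx', hx.1⟩) rfl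
    have hsub : Set.Ioo a b ∩ {x | G x ≤ t} ⊆
        ((Set.Ioo a z ∩ {x | G x ≤ t}) ∪ (Set.Ioo z b ∩ {x | G x ≤ t})) ∪ {z} := by
      rintro x ⟨hx, hxt⟩
      rcases lt_trichotomy x z with h | h | h
      · exact Or.inl (Or.inl ⟨⟨hx.1, h⟩, hxt⟩)
      · exact Or.inr h
      · exact Or.inl (Or.inr ⟨⟨h, hx.2⟩, hxt⟩)
    calc ∫⁻ x in Set.Ioo a b ∩ {x | G x ≤ t}, ENNReal.ofReal |deriv G x|
        ≤ _ := lintegral_mono_set hsub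
      _ ≤ _ := lintegral_union_le _ _ _
      _ ≤ _ := add_le_add (lintegral_union_le _ _ _) le_rfl
      _ ≤ _ := add_le_add (add_le_add hl hr) (setLIntegral_measure_zero _ _ (by simp)).le
      _ = (((Z.filter (· < z)).card + (Z.filter (z < ·)).card + 1 : ℕ) + 1) *
            ENNReal.ofReal t := by push_cast; ring
      _ ≤ (n + 1) * ENNReal.ofReal t := by gcongr
  · have hne : ∀ x ∈ Set.Ioo a b, deriv G x ≠ 0 := fun x hx h => hex ⟨x, hx, hZ x hx h⟩
    have hinj : Set.InjOn G (Set.Ioo a b) := by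
      have aux : ∀ x ∈ Set.Ioo a b, ∀ y ∈ Set.Ioo a b, x < y → G x ≠ G y := by
        intro x hx y hy hxy h
        obtain ⟨c, hc, hc'⟩ := exists_deriv_eq_zero hxy hG.continuous.continuousOn h
        exact hne c ⟨hx.1.trans hc.1, hc.2.trans hy.2⟩ hc'
      intro x hx y hy h
      rcases lt_trichotomy x y with hxy | hxy | hxy
      · exact absurd h (aux x hx y hy hxy)
      · exact hxy
      · exact absurd h.symm (aux y hy x hx hxy)
    have hmeas : MeasurableSet (Set.Ioo a b ∩ {x | G x ≤ t}) :=
      measurableSet_Ioo.inter (isClosed_le hG.continuous continuous_const).measurableSet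
    have hchange := lintegral_image_eq_lintegral_abs_deriv_mul hmeas
      (fun x _ => (hG x).hasDerivAt.hasDerivWithinAt) (hinj.mono Set.inter_subset_left)
      (fun _ => 1)
    simp only [mul_one, setLIntegral_one] at hchange
    rw [← hchange]
    calc volume (G '' (Set.Ioo a b ∩ {x | G x ≤ t})) ≤ volume (Set.Icc 0 t) := by
          refine measure_mono ?_
          rintro _ ⟨x, hx, rfl⟩
          exact ⟨h0 x, hx.2⟩
      _ = 1 * ENNReal.ofReal t := by simp
      _ ≤ (n + 1) * ENNReal.ofReal t := by gcongr; simp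

/-- The common form of `Gp` (for `s = 1`) and `Gm` (for `s = -1`). -/
noncomputable def signedG (s x : ℝ) : ℝ :=
  3 + 2 * (Real.cos (2 * Real.pi * x) + s * Real.cos (12 * Real.pi * x) +
    s * Real.cos (14 * Real.pi * x))

lemma hasDerivAt_signedG (s x : ℝ) :
    HasDerivAt (signedG s) (-(4 * Real.pi) * (Real.sin (2 * Real.pi * x) +
      s * (6 * Real.sin (12 * Real.pi * x)) + s * (7 * Real.sin (14 * Real.pi * x)))) x := by
  have h (c : ℝ) : HasDerivAt (fun x => Real.cos (c * x)) (-Real.sin (c * x) * c) x := by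
    simpa using ((hasDerivAt_id x).const_mul c).cos
  exact (((((h (2 * Real.pi)).add ((h (12 * Real.pi)).const_mul s)).add
    ((h (14 * Real.pi)).const_mul s)).const_mul 2).const_add 3).congr_deriv (by ring)

lemma deriv_signedG (s : ℝ) :
    deriv (signedG s) = fun x => -(4 * Real.pi) * (Real.sin (2 * Real.pi * x) +
      s * (6 * Real.sin (12 * Real.pi * x)) + s * (7 * Real.sin (14 * Real.pi * x))) :=
  funext fun x => (hasDerivAt_signedG s x).deriv

lemma hasDerivAt_deriv_signedG (s x : ℝ) :
    HasDerivAt (deriv (signedG s)) (-(8 * Real.pi ^ 2) * (Real.cos (2 * Real.pi * x) +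
      s * (36 * Real.cos (12 * Real.pi * x)) + s * (49 * Real.cos (14 * Real.pi * x)))) x := by
  rw [deriv_signedG]
  have h (c : ℝ) : HasDerivAt (fun x => Real.sin (c * x)) (Real.cos (c * x) * c) x := by
    simpa using ((hasDerivAt_id x).const_mul c).sin
  exact ((((h (2 * Real.pi)).add (((h (12 * Real.pi)).const_mul 6).const_mul s)).add
    (((h (14 * Real.pi)).const_mul 7).const_mul s)).const_mul (-(4 * Real.pi))).congr_deriv
      (by ring)

lemma iteratedDeriv_two_signedG (s : ℝ) :
    iteratedDeriv 2 (signedG s) = fun x => -(8 * Real.pi ^ 2) * (Real.cos (2 * Real.pi * x) +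
      s * (36 * Real.cos (12 * Real.pi * x)) + s * (49 * Real.cos (14 * Real.pi * x))) := by
  rw [iteratedDeriv_succ, iteratedDeriv_one]
  exact funext fun x => (hasDerivAt_deriv_signedG s x).deriv

lemma signedG_nonneg {s : ℝ} (hs : s ^ 2 = 1) (x : ℝ) : 0 ≤ signedG s x := by
  have h1 := Real.cos_sq_add_sin_sq (2 * Real.pi * x)
  have h7 := Real.cos_sq_add_sin_sq (14 * Real.pi * x)
  have h6 : Real.cos (12 * Real.pi * x) = Real.cos (14 * Real.pi * x) * Real.cos (2 * Real.pi * x) +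
      Real.sin (14 * Real.pi * x) * Real.sin (2 * Real.pi * x) := by
    rw [← Real.cos_sub]; ring_nf
  have key : signedG s x = (1 + Real.cos (2 * Real.pi * x) + s * Real.cos (14 * Real.pi * x)) ^ 2 +
      (Real.sin (2 * Real.pi * x) + s * Real.sin (14 * Real.pi * x)) ^ 2 := by
    rw [signedG, h6]
    linear_combination -h1 - s ^ 2 * h7 - hs
  rw [key]
  positivity

lemma integral_cos_int_mul_pi_eq_zero {k : ℤ} (hk : k ≠ 0) :
    ∫ x in (-(1 : ℝ) / 2)..(1 / 2), Real.cos (2 * k * Real.pi * x) = 0 := by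
  have hk' : (2 * k * Real.pi : ℝ) ≠ 0 := by
    have : (k : ℝ) ≠ 0 := mod_cast hk
    positivity
  rw [intervalIntegral.integral_comp_mul_left (fun x => Real.cos x) hk', integral_cos,
    show 2 * (k : ℝ) * Real.pi * (1 / 2) = k * Real.pi by ring,
    show 2 * (k : ℝ) * Real.pi * (-1 / 2) = -(k * Real.pi) by ring, Real.sin_neg,
    Real.sin_int_mul_pi]
  simp

lemma integral_sq_iteratedDeriv_two_signedG {s : ℝ} (hs : s ^ 2 = 1) :
    ∫ x in (-(1 : ℝ) / 2)..(1 / 2), iteratedDeriv 2 (signedG s) x ^ 2 =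
      (344 * Real.pi ^ 2) ^ 2 := by
  have e : ∀ x, iteratedDeriv 2 (signedG s) x ^ 2 =
      32 * Real.pi ^ 4 * (3698 + Real.cos (2 * (2 : ℤ) * Real.pi * x) +
        1296 * Real.cos (2 * (12 : ℤ) * Real.pi * x) +
        2401 * Real.cos (2 * (14 : ℤ) * Real.pi * x) +
        72 * s * (Real.cos (2 * (5 : ℤ) * Real.pi * x) + Real.cos (2 * (7 : ℤ) * Real.pi * x)) +
        98 * s * (Real.cos (2 * (6 : ℤ) * Real.pi * x) + Real.cos (2 * (8 : ℤ) * Real.pi * x)) +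
        3528 * (Real.cos (2 * (1 : ℤ) * Real.pi * x) +
          Real.cos (2 * (13 : ℤ) * Real.pi * x))) := by
    intro x
    have prod (u v : ℝ) : Real.cos (u - v) + Real.cos (u + v) = 2 * Real.cos u * Real.cos v := by
      rw [Real.cos_sub, Real.cos_add]; ring
    have p11 := prod (2 * Real.pi * x) (2 * Real.pi * x)
    have p66 := prod (12 * Real.pi * x) (12 * Real.pi * x)
    have p77 := prod (14 * Real.pi * x) (14 * Real.pi * x)
    have p61 := prod (12 * Real.pi * x) (2 * Real.pi * x)
    have p71 := prod (14 * Real.pi * x) (2 * Real.pi * x)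
    have p76 := prod (14 * Real.pi * x) (12 * Real.pi * x)
    rw [sub_self, Real.cos_zero] at p11 p66 p77
    rw [iteratedDeriv_two_signedG]
    push_cast
    rw [show 2 * Real.pi * x + 2 * Real.pi * x = 2 * 2 * Real.pi * x by ring] at p11
    rw [show 12 * Real.pi * x + 12 * Real.pi * x = 2 * 12 * Real.pi * x by ring] at p66
    rw [show 14 * Real.pi * x + 14 * Real.pi * x = 2 * 14 * Real.pi * x by ring] at p77
    rw [show 12 * Real.pi * x - 2 * Real.pi * x = 2 * 5 * Real.pi * x by ring,
      show 12 * Real.pi * x + 2 * Real.pi * x = 2 * 7 * Real.pi * x by ring] at p61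
    rw [show 14 * Real.pi * x - 2 * Real.pi * x = 2 * 6 * Real.pi * x by ring,
      show 14 * Real.pi * x + 2 * Real.pi * x = 2 * 8 * Real.pi * x by ring] at p71
    rw [show 14 * Real.pi * x - 12 * Real.pi * x = 2 * 1 * Real.pi * x by ring,
      show 14 * Real.pi * x + 12 * Real.pi * x = 2 * 13 * Real.pi * x by ring] at p76
    linear_combination (-32 * Real.pi ^ 4) * (p11 + 1296 * p66 + 2401 * p77 + 72 * s * p61 +
      98 * s * p71 + 3528 * p76) + 64 * Real.pi ^ 4 * (1296 * Real.cos (12 * Real.pi * x) ^ 2 +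
      2401 * Real.cos (14 * Real.pi * x) ^ 2 +
      3528 * Real.cos (12 * Real.pi * x) * Real.cos (14 * Real.pi * x)) * hs
  have hint {f : ℝ → ℝ} (hf : Continuous f) :
      IntervalIntegrable f volume (-(1 : ℝ) / 2) (1 / 2) := hf.intervalIntegrable _ _
  simp only [e, intervalIntegral.integral_const_mul]
  iterate 6 rw [intervalIntegral.integral_add (hint (by fun_prop)) (hint (by fun_prop))]
  simp only [intervalIntegral.integral_const_mul]
  iterate 3 rw [intervalIntegral.integral_add (hint (by fun_prop)) (hint (by fun_prop))]
  rw [intervalIntegral.integral_const]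
  repeat rw [integral_cos_int_mul_pi_eq_zero (by norm_num)]
  norm_num
  ring

open Polynomial in
/-- The critical points of `signedG s` in an interval where `cos (2πx)` is injective and
`sin (2πx)` does not vanish are at most six. -/
lemma exists_finset_critical_signedG {s : ℝ} (hs : s ^ 2 = 1) {a b : ℝ}
    (hinj : Set.InjOn (fun x => Real.cos (2 * Real.pi * x)) (Set.Ioo a b))
    (hsin : ∀ x ∈ Set.Ioo a b, Real.sin (2 * Real.pi * x) ≠ 0) :
    ∃ Z : Finset ℝ, Z.card ≤ 6 ∧ ∀ x ∈ Set.Ioo a b, deriv (signedG s) x = 0 → x ∈ Z := by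
  classical
  let Q : ℝ[X] := 1 + C (s * 6) * Chebyshev.U ℝ 5 + C (s * 7) * Chebyshev.U ℝ 6
  have hQ0 : Q ≠ 0 := by
    intro h
    have h1 : Q.eval 1 = 0 := by rw [h, eval_zero]
    simp only [Q, eval_add, eval_mul, eval_C, eval_one, Chebyshev.U_eval_one] at h1
    push_cast at h1
    nlinarith
  have hdeg : Q.natDegree ≤ 6 := by
    have h5 : (Chebyshev.U ℝ 5).natDegree = 5 := Chebyshev.natDegree_U_natCast ℝ 5
    have h6 : (Chebyshev.U ℝ 6).natDegree = 6 := Chebyshev.natDegree_U_natCast ℝ 6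
    refine natDegree_add_le_of_degree_le (natDegree_add_le_of_degree_le (by simp) ?_) ?_
    · exact (natDegree_C_mul_le _ _).trans (by omega)
    · exact (natDegree_C_mul_le _ _).trans (by omega)
  have hroot : ∀ x ∈ Set.Ioo a b, deriv (signedG s) x = 0 →
      Real.cos (2 * Real.pi * x) ∈ Q.roots.toFinset := by
    intro x hx hd
    rw [Multiset.mem_toFinset, mem_roots hQ0, IsRoot.def]
    have u5 := Chebyshev.U_real_cos (2 * Real.pi * x) 5
    have u6 := Chebyshev.U_real_cos (2 * Real.pi * x) 6
    rw [show (((5 : ℤ) : ℝ) + 1) * (2 * Real.pi * x) = 12 * Real.pi * x by push_cast; ring] at u5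
    rw [show (((6 : ℤ) : ℝ) + 1) * (2 * Real.pi * x) = 14 * Real.pi * x by push_cast; ring] at u6
    have hd' : Real.sin (2 * Real.pi * x) + s * (6 * Real.sin (12 * Real.pi * x)) +
        s * (7 * Real.sin (14 * Real.pi * x)) = 0 := by
      rw [deriv_signedG] at hd
      exact (mul_eq_zero.1 hd).resolve_left (by simp [Real.pi_ne_zero])
    refine (mul_eq_zero.1 ?_).resolve_right (hsin x hx)
    simp only [Q, eval_add, eval_mul, eval_C, eval_one]
    rw [← hd', ← u5, ← u6]
    ring
  let g : ℝ → ℝ := Function.invFunOn (fun x => Real.cos (2 * Real.pi * x)) (Set.Ioo a b)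
  refine ⟨Q.roots.toFinset.image g, ?_, fun x hx hd => ?_⟩
  · exact Finset.card_image_le.trans ((Multiset.toFinset_card_le _).trans
      ((card_roots' Q).trans hdeg))
  · exact Finset.mem_image.2 ⟨_, hroot x hx hd, hinj.leftInvOn_invFunOn hx⟩

lemma setLIntegral_signedG_le {s : ℝ} (hs : s ^ 2 = 1) {a b : ℝ}
    (hinj : Set.InjOn (fun x => Real.cos (2 * Real.pi * x)) (Set.Ioo a b))
    (hsin : ∀ x ∈ Set.Ioo a b, Real.sin (2 * Real.pi * x) ≠ 0) :
    ∫⁻ x in Set.Ioo a b ∩ {x | signedG s x ≤ 1 / 9}, ENNReal.ofReal |deriv (signedG s) x| ≤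
      ENNReal.ofReal (7 / 9) := by
  obtain ⟨Z, hcard, hZ⟩ := exists_finset_critical_signedG hs hinj hsin
  refine (setLIntegral_abs_deriv_sublevel_le
    (fun x => (hasDerivAt_signedG s x).differentiableAt) (signedG_nonneg hs) (1 / 9) Z a b
    hZ).trans ?_
  calc ((Z.card : ENNReal) + 1) * ENNReal.ofReal (1 / 9)
      ≤ ((6 : ℕ) + 1) * ENNReal.ofReal (1 / 9) := by gcongr
    _ = ENNReal.ofReal 7 * ENNReal.ofReal (1 / 9) := by norm_num
    _ = ENNReal.ofReal (7 / 9) := by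
      rw [← ENNReal.ofReal_mul (by norm_num)]; norm_num

lemma setLIntegral_signedG_period_le {s : ℝ} (hs : s ^ 2 = 1) :
    ∫⁻ x in Set.Ioc (-(1 : ℝ) / 2) (1 / 2) ∩ {x | signedG s x ≤ 1 / 9},
      ENNReal.ofReal |deriv (signedG s) x| ≤ ENNReal.ofReal (14 / 9) := by
  have hpi := Real.pi_pos
  have hr := setLIntegral_signedG_le hs (a := 0) (b := 1 / 2)
    (fun x hx y hy h => by
      have := Real.injOn_cos (x₁ := 2 * Real.pi * x) (x₂ := 2 * Real.pi * y)
        ⟨by nlinarith [hx.1], by nlinarith [hx.2]⟩ ⟨by nlinarith [hy.1], by nlinarith [hy.2]⟩ h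
      exact mul_left_cancel₀ (by positivity) this)
    (fun x hx => (Real.sin_pos_of_pos_of_lt_pi (by nlinarith [hx.1]) (by nlinarith [hx.2])).ne')
  have hl := setLIntegral_signedG_le hs (a := -1 / 2) (b := 0)
    (fun x hx y hy h => by
      have := Real.injOn_cos (x₁ := -(2 * Real.pi * x)) (x₂ := -(2 * Real.pi * y))
        ⟨by nlinarith [hx.2], by nlinarith [hx.1]⟩ ⟨by nlinarith [hy.2], by nlinarith [hy.1]⟩
        (by simpa using h)
      exact mul_left_cancel₀ (by positivity) (neg_injective this))
    (fun x hx => (Real.sin_neg_of_neg_of_neg_pi_lt (by nlinarith [hx.2])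
      (by nlinarith [hx.1])).ne)
  have hsub : Set.Ioc (-(1 : ℝ) / 2) (1 / 2) ∩ {x | signedG s x ≤ 1 / 9} ⊆
      ((Set.Ioo (-1 / 2) 0 ∩ {x | signedG s x ≤ 1 / 9}) ∪
        (Set.Ioo 0 (1 / 2) ∩ {x | signedG s x ≤ 1 / 9})) ∪ {0, 1 / 2} := by
    rintro x ⟨hx, hxt⟩
    rcases lt_trichotomy x 0 with h | h | h
    · exact Or.inl (Or.inl ⟨⟨hx.1, h⟩, hxt⟩)
    · exact Or.inr (Or.inl h)
    · rcases eq_or_lt_of_le hx.2 with h' | h'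
      · exact Or.inr (Or.inr h')
      · exact Or.inl (Or.inr ⟨⟨h, h'⟩, hxt⟩)
  have hnull : volume ({0, 1 / 2} : Set ℝ) = 0 := (Set.toFinite _).measure_zero _
  calc _ ≤ _ := lintegral_mono_set hsub
    _ ≤ _ := lintegral_union_le _ _ _
    _ ≤ _ := add_le_add (lintegral_union_le _ _ _) le_rfl
    _ ≤ _ := add_le_add (add_le_add hl hr) (setLIntegral_measure_zero _ _ hnull).le
    _ = ENNReal.ofReal (14 / 9) := by
      rw [add_zero, ← ENNReal.ofReal_add (by norm_num) (by norm_num)]; norm_num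

lemma deriv_signedG_half (s : ℝ) : deriv (signedG s) (1 / 2) = 0 := by
  have h (k : ℕ) : Real.sin (2 * k * Real.pi * (1 / 2)) = 0 := by
    rw [show 2 * (k : ℝ) * Real.pi * (1 / 2) = k * Real.pi by ring, Real.sin_nat_mul_pi]
  have h1 := h 1
  have h6 := h 6
  have h7 := h 7
  rw [show 2 * ((1 : ℕ) : ℝ) * Real.pi = 2 * Real.pi by norm_num] at h1
  rw [show 2 * ((6 : ℕ) : ℝ) * Real.pi = 12 * Real.pi by norm_num] at h6
  rw [show 2 * ((7 : ℕ) : ℝ) * Real.pi = 14 * Real.pi by norm_num] at h7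
  simp only [deriv_signedG, h1, h6, h7]
  ring

lemma deriv_signedG_neg (s x : ℝ) : deriv (signedG s) (-x) = -deriv (signedG s) x := by
  simp only [deriv_signedG, mul_neg, Real.sin_neg]
  ring

lemma integral_indicator_signedG_le {s : ℝ} (hs : s ^ 2 = 1) :
    ∫ x in (-(1 : ℝ) / 2)..(1 / 2),
      Set.indicator {x | signedG s x ≤ 1 / 9} (fun x => |deriv (signedG s) x|) x ≤ 14 / 9 := by
  have hG : Continuous (signedG s) := by unfold signedG; fun_prop
  have hX : MeasurableSet {x | signedG s x ≤ 1 / 9} :=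
    (isClosed_le hG continuous_const).measurableSet
  have hd : Continuous (deriv (signedG s)) := by rw [deriv_signedG]; fun_prop
  rw [intervalIntegral.integral_of_le (by norm_num), setIntegral_indicator hX,
    integral_eq_lintegral_of_nonneg_ae (Filter.Eventually.of_forall fun _ => abs_nonneg _)
      hd.abs.aestronglyMeasurable]
  exact ENNReal.toReal_le_of_le_ofReal (by norm_num) (setLIntegral_signedG_period_le hs)

theorem stmt18 (G : ℝ → ℝ) (hG : G = Gp ∨ G = Gm) :
    eVariationOn (Set.indicator {x : ℝ | G x ≤ 1/9} (deriv G)) (Set.Icc (-(1:ℝ)/2) (1/2)) ≤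
      eVariationOn (deriv G) (Set.Icc (-(1:ℝ)/2) (1/2)) ∧
    eVariationOn (deriv G) (Set.Icc (-(1:ℝ)/2) (1/2)) ≤
      ENNReal.ofReal (Real.sqrt (∫ x in (-(1:ℝ)/2)..(1/2), (iteratedDeriv 2 G x) ^ 2)) ∧
    Real.sqrt (∫ x in (-(1:ℝ)/2)..(1/2), (iteratedDeriv 2 G x) ^ 2) < 3400 ∧
    (∫ x in (-(1:ℝ)/2)..(1/2),
        Set.indicator {x : ℝ | G x ≤ 1/9} (fun x => |deriv G x|) x) ≤ 14/9 := by
  obtain ⟨s, hs, rfl⟩ : ∃ s : ℝ, s ^ 2 = 1 ∧ G = signedG s := by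
    rcases hG with rfl | rfl
    · exact ⟨1, by norm_num, by ext x; simp [Gp, signedG]⟩
    · exact ⟨-1, by norm_num, by ext x; simp [Gm, signedG]; ring⟩
  have hhalf := deriv_signedG_half s
  have hneg : deriv (signedG s) (-1 / 2) = 0 := by
    rw [neg_div, deriv_signedG_neg, hhalf, neg_zero]
  have hcont : Continuous (signedG s) := by unfold signedG; fun_prop
  have hcont2 : Continuous (iteratedDeriv 2 (signedG s)) := by
    rw [iteratedDeriv_two_signedG]; fun_prop
  refine ⟨eVariationOn_indicator_deriv_le hcont _ hneg hhalf, ?_, ?_,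
    integral_indicator_signedG_le hs⟩
  · have hder : ∀ x, HasDerivAt (deriv (signedG s)) (iteratedDeriv 2 (signedG s) x) x :=
      fun x => by
        rw [iteratedDeriv_two_signedG]
        exact hasDerivAt_deriv_signedG s x
    exact (eVariationOn_Icc_le_integral_abs hder hcont2 _ _).trans
      (ENNReal.ofReal_le_ofReal (integral_abs_le_sqrt_integral_sq hcont2 (by norm_num)))
  · rw [integral_sq_iteratedDeriv_two_signedG hs, Real.sqrt_sq (by positivity)]
    nlinarith [Real.pi_lt_d4, Real.pi_pos]
end
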